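/- arXiv:cs/0606053 — 2 statements merged into one kernel-verified Lean document; each statement's English description precedes it below -/
import Mathlib

section
/- A language L of nonempty words over a finite alphabet Σ is accepted by some synchronous rational graph between rational sets of initial and final vertices if and only if L is the word language of some tiling system; that is, the languages accepted by synchronous rational graphs between rational sets of initial and final vertices are exactly the languages recognized by tiling systems (equivalently, the context-sensitive languages). -/
/-!  Common definitions: transducers, rational graphs, regular languages,
pictures and tiling systems, following Carayol & Meyer,
"Context-Sensitive Languages, Rational Graphs and Determinism". -/

/-- A set of words is regular (rational) if it is recognized by a finite automaton. -/
def Regular {Γ : Type} (L : Set (List Γ)) : Prop :=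
  ∃ (Q : Type) (_ : Fintype Q) (M : DFA Γ Q), M.accepts = L

/-- A finite transducer over the alphabet `Γ`: a finite automaton whose
transitions are labeled by pairs in `(Γ ∪ {ε}) × (Γ ∪ {ε})`,
where `none` encodes the empty word ε. -/
structure Transducer (Γ : Type) where
  /-- states -/
  Q : Type
  /-- the set of states is finite -/
  fintypeQ : Fintype Q
  /-- initial state -/
  init : Q
  /-- final states -/
  final : Set Q
  /-- transition relation -/
  trans : Q → Option Γ × Option Γ → Q → Prop

namespace Transducer

variable {Γ : Type}

/-- Paths in a transducer, recording the list of transition labels. -/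
inductive Path (T : Transducer Γ) : T.Q → List (Option Γ × Option Γ) → T.Q → Prop
  | nil (q : T.Q) : Path T q [] q
  | cons {q q' q'' : T.Q} {l : Option Γ × Option Γ} {ls : List (Option Γ × Option Γ)} :
      T.trans q l q' → Path T q' ls q'' → Path T q (l :: ls) q''

/-- Input word of a list of transition labels (concatenation of first components). -/
def ins (ls : List (Option Γ × Option Γ)) : List Γ := ls.flatMap fun l => l.1.toList

/-- Output word of a list of transition labels (concatenation of second components). -/
def outs (ls : List (Option Γ × Option Γ)) : List Γ := ls.flatMap fun l => l.2.toList

/-- The binary relation on `Γ*` recognized by the transducer: pairs `(u,v)`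
obtained by concatenating componentwise the labels along an accepting run. -/
def Accepts (T : Transducer Γ) (u v : List Γ) : Prop :=
  ∃ (q : T.Q) (ls : List (Option Γ × Option Γ)),
    T.Path T.init ls q ∧ q ∈ T.final ∧ ins ls = u ∧ outs ls = v

/-- A transducer is synchronous if all its transitions are labeled by pairs
of letters of `Γ` (no ε). -/
def Synchronous (T : Transducer Γ) : Prop :=
  ∀ (q q' : T.Q) (l : Option Γ × Option Γ), T.trans q l q' → l.1.isSome ∧ l.2.isSome

/-- A transducer is (left-)synchronized if every path from the initial state
consists of a prefix of transitions labeled by pairs of letters of `Γ`,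
followed by transitions which are all ε on the input side, or all ε on the
output side. -/
def Synchronized (T : Transducer Γ) : Prop :=
  ∀ (q : T.Q) (ls : List (Option Γ × Option Γ)), T.Path T.init ls q →
    ∃ k : ℕ, (∀ l ∈ ls.take k, l.1.isSome ∧ l.2.isSome) ∧
      ((∀ l ∈ ls.drop k, l.1 = none) ∨ (∀ l ∈ ls.drop k, l.2 = none))

/-- A transducer is sequential if for any two transitions from a common state,
either they coincide, or their input letters are distinct letters of `Γ`. -/
def Sequential (T : Transducer Γ) : Prop :=
  ∀ (q q' q'' : T.Q) (x y x' y' : Option Γ),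
    T.trans q (x, y) q' → T.trans q (x', y') q'' →
    (x = x' ∧ y = y' ∧ q' = q'') ∨ (x ≠ none ∧ x' ≠ none ∧ x ≠ x')

/-- A transducer is deterministic if no two distinct transitions from the same
state carry the same label. -/
def Deterministic (T : Transducer Γ) : Prop :=
  ∀ (q q' q'' : T.Q) (l : Option Γ × Option Γ),
    T.trans q l q' → T.trans q l q'' → q' = q''

end Transducer

/-- A rational graph labeled by the alphabet `A` with vertices in `Γ*`,
given by one transducer over `Γ` per label. -/
structure RationalGraph (A Γ : Type) where
  /-- the transducer defining the edges labeled by a given letter -/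
  trans : A → Transducer Γ

namespace RationalGraph

variable {A Γ : Type}

/-- There is an edge `u →a v` iff `(u,v)` is recognized by the transducer `T_a`. -/
def Edge (G : RationalGraph A Γ) (u : List Γ) (a : A) (v : List Γ) : Prop :=
  (G.trans a).Accepts u v

/-- A synchronous rational graph is defined by synchronous transducers. -/
def Synchronous (G : RationalGraph A Γ) : Prop := ∀ a : A, (G.trans a).Synchronous

/-- A synchronized rational graph is defined by synchronized transducers. -/
def Synchronized (G : RationalGraph A Γ) : Prop := ∀ a : A, (G.trans a).Synchronized

/-- A sequential rational graph is defined by sequential transducers. -/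
def Sequential (G : RationalGraph A Γ) : Prop := ∀ a : A, (G.trans a).Sequential

/-- `vs` is the sequence of vertices of a path labeled by the word `w`. -/
def IsPath (G : RationalGraph A Γ) (vs : List (List Γ)) (w : List A) : Prop :=
  vs.length = w.length + 1 ∧
  ∀ (k : ℕ) (a : A) (u v : List Γ),
    w[k]? = some a → vs[k]? = some u → vs[k + 1]? = some v → G.Edge u a v

/-- The path language of `G` between the sets of vertices `I` and `F`:
all words labeling a path from a vertex of `I` to a vertex of `F`. -/
def Lang (G : RationalGraph A Γ) (I F : Set (List Γ)) : Set (List A) :=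
  { w | ∃ (vs : List (List Γ)) (i f : List Γ), G.IsPath vs w ∧
      vs.head? = some i ∧ i ∈ I ∧ vs.getLast? = some f ∧ f ∈ F }

/-- A graph has finite out-degree if every vertex has finitely many outgoing edges. -/
def FiniteOutDegree (G : RationalGraph A Γ) : Prop :=
  ∀ u : List Γ, { p : A × List Γ | G.Edge u p.1 p.2 }.Finite

/-- The out-degree of a vertex: the number of its outgoing edges. -/
noncomputable def outDegree (G : RationalGraph A Γ) (u : List Γ) : ℕ :=
  { p : A × List Γ | G.Edge u p.1 p.2 }.ncard

/-- Two vertices are adjacent if some edge (in either direction, ignoring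
labels) connects them. -/
def Adj (G : RationalGraph A Γ) (u v : List Γ) : Prop :=
  (∃ a, G.Edge u a v) ∨ (∃ a, G.Edge v a u)

end RationalGraph

/-- `chainN R n u v` holds iff there is a sequence of `n` `R`-steps from `u` to `v`. -/
def chainN {α : Type} (R : α → α → Prop) : ℕ → α → α → Prop
  | 0, u, v => u = v
  | n + 1, u, w => ∃ v, R u v ∧ chainN R n v w

/-- `IsDist R x v n` : the length of a shortest `R`-sequence from `x` to `v` is `n`. -/
def IsDist {α : Type} (R : α → α → Prop) (x v : α) (n : ℕ) : Prop :=
  chainN R n x v ∧ ∀ m : ℕ, chainN R m x v → n ≤ m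

/-- A 2×2 tile over the alphabet `Λ`. -/
structure Tile (Λ : Type) where
  /-- top-left letter -/
  tl : Λ
  /-- top-right letter -/
  tr : Λ
  /-- bottom-left letter -/
  bl : Λ
  /-- bottom-right letter -/
  br : Λ

/-- The set of 2×2 tiles appearing in a picture given as a list of rows. -/
def tilesOf {Λ : Type} (rows : List (List Λ)) : Set (Tile Λ) :=
  { t | ∃ (i j : ℕ) (r₁ r₂ : List Λ), rows[i]? = some r₁ ∧ rows[i + 1]? = some r₂ ∧
      r₁[j]? = some t.tl ∧ r₁[j + 1]? = some t.tr ∧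
      r₂[j]? = some t.bl ∧ r₂[j + 1]? = some t.br }

/-- The picture of width `m` framed by the border symbol `#` (encoded by `none`). -/
def framed {Λ : Type} (rows : List (List Λ)) (m : ℕ) : List (List (Option Λ)) :=
  List.replicate (m + 2) none ::
    (rows.map fun r => none :: (r.map some ++ [none])) ++
      [List.replicate (m + 2) none]

/-- A tiling system with input alphabet `A` and work alphabet `Λ`
(the frame symbol `#` is encoded by `none : Option Λ`). -/
structure TilingSystem (A Λ : Type) where
  /-- the embedding of the input alphabet into the work alphabet -/
  emb : A → Λ
  /-- the input alphabet is a sub-alphabet of the work alphabet -/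
  emb_inj : Function.Injective emb
  /-- the (finite, as `Λ` is finite) set of allowed tiles over `Λ ∪ {#}` -/
  tiles : Set (Tile (Option Λ))

namespace TilingSystem

variable {A Λ : Type}

/-- `S.Pic rows n m` : `rows` is an `(n,m)`-picture of the picture language of `S`,
i.e. all 2×2 tiles of the framed picture belong to the tiles of `S`. -/
def Pic (S : TilingSystem A Λ) (rows : List (List Λ)) (n m : ℕ) : Prop :=
  0 < n ∧ 0 < m ∧ rows.length = n ∧ (∀ r ∈ rows, r.length = m) ∧
    tilesOf (framed rows m) ⊆ S.tiles

/-- The word language of a tiling system: frontiers (first rows) of accepted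
pictures that are words over the input alphabet. -/
def Lang (S : TilingSystem A Λ) : Set (List A) :=
  { w | ∃ (rows : List (List Λ)) (n : ℕ),
      S.Pic rows n w.length ∧ rows.head? = some (w.map S.emb) }

/-- A tiling system is deterministic if each row determines at most one
possible next row. -/
def Deterministic (S : TilingSystem A Λ) : Prop :=
  ∀ u v v' : List (Option Λ), v.length = u.length → v'.length = u.length →
    tilesOf [none :: u ++ [none], none :: v ++ [none]] ⊆ S.tiles →
    tilesOf [none :: u ++ [none], none :: v' ++ [none]] ⊆ S.tiles → v = v'

end TilingSystem
namespace SyncTiling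

/-- Runs of a labelled transition relation. -/
def Run {Q X : Type} (δ : Q → X → Q → Prop) : Q → List X → Q → Prop
  | q, [], q' => q = q'
  | q, x :: xs, q' => ∃ p, δ q x p ∧ Run δ p xs q'

theorem run_iff {Q X : Type} (δ : Q → X → Q → Prop) (xs : List X) (q q' : Q) :
    Run δ q xs q' ↔ ∃ s : ℕ → Q, s 0 = q ∧ s xs.length = q' ∧
      ∀ i (h : i < xs.length), δ (s i) xs[i] (s (i + 1)) := by
  induction xs generalizing q with
  | nil =>
    constructor
    · intro h
      exact ⟨fun _ => q, rfl, h, fun i h => by simp at h⟩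
    · rintro ⟨s, rfl, rfl, _⟩
      rfl
  | cons x xs ih =>
    constructor
    · rintro ⟨p, hp, hr⟩
      obtain ⟨s, h0, hl, hs⟩ := (ih p).1 hr
      refine ⟨fun i => Nat.casesOn i q s, rfl, hl, ?_⟩
      intro i h
      cases i with
      | zero => simpa [h0] using hp
      | succ i => exact hs i (by simpa using h)
    · rintro ⟨s, h0, hl, hs⟩
      refine ⟨s 1, ?_, (ih _).2 ⟨fun i => s (i + 1), rfl, hl, ?_⟩⟩
      · have := hs 0 (by simp)
        simpa [h0] using this
      · intro i h
        exact hs (i + 1) (by simpa using h)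

theorem dfa_run {Γ Q : Type} (M : DFA Γ Q) (xs : List Γ) (q q' : Q) :
    Run (fun q x p => p = M.step q x) q xs q' ↔ M.evalFrom q xs = q' := by
  induction xs generalizing q with
  | nil => simp [Run]
  | cons x xs ih => simp [Run, ih]

theorem regular_run {Γ : Type} {I : Set (List Γ)} (h : Regular I) :
    ∃ (Q : Type) (_ : Fintype Q) (st : Q) (step : Q → Γ → Q) (acc : Set Q), ∀ u, u ∈ I ↔
      ∃ s : ℕ → Q, s 0 = st ∧ s u.length ∈ acc ∧
        ∀ i (h : i < u.length), s (i + 1) = step (s i) u[i] := by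
  obtain ⟨Q, hQ, M, rfl⟩ := h
  refine ⟨Q, hQ, M.start, M.step, M.accept, fun u => ?_⟩
  have := dfa_run M u M.start
  have h2 : u ∈ M.accepts ↔ M.evalFrom M.start u ∈ M.accept := Iff.rfl
  constructor
  · intro hu
    obtain ⟨s, h0, hl, hs⟩ := (run_iff _ _ _ _).1 ((this _).2 rfl)
    exact ⟨s, h0, by rw [hl]; exact hu, hs⟩
  · rintro ⟨s, h0, hl, hs⟩
    have h3 := (this _).1 ((run_iff _ _ _ _).2 ⟨s, h0, rfl, hs⟩)
    change M.evalFrom M.start u ∈ M.accept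
    rw [h3]
    exact hl

theorem nfa_run {Γ Q : Type} (M : NFA Γ Q) (xs : List Γ) (S : Set Q) (q' : Q) :
    q' ∈ M.evalFrom S xs ↔ ∃ q ∈ S, Run (fun q x p => p ∈ M.step q x) q xs q' := by
  induction xs generalizing S with
  | nil => simp [Run]
  | cons x xs ih =>
    rw [NFA.evalFrom_cons, ih]
    constructor
    · rintro ⟨q, hq, hr⟩
      obtain ⟨t, ht, hs⟩ := NFA.mem_stepSet.1 hq
      exact ⟨t, ht, q, hs, hr⟩
    · rintro ⟨t, ht, q, hs, hr⟩
      exact ⟨q, NFA.mem_stepSet.2 ⟨t, ht, hs⟩, hr⟩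

theorem regular_of_run {Γ Q : Type} [Fintype Q] (δ : Q → Γ → Q → Prop) (q₀ : Q) (acc : Set Q) :
    Regular {u : List Γ | ∃ q ∈ acc, Run δ q₀ u q} := by
  classical
  let M : NFA Γ Q := { step := fun q x => {p | δ q x p}, start := {q₀}, accept := acc }
  refine ⟨Set Q, inferInstance, M.toDFA, ?_⟩
  rw [NFA.toDFA_correct]
  apply Set.ext
  intro u
  have h : u ∈ M.accepts ↔ ∃ q ∈ acc, q ∈ M.evalFrom {q₀} u := NFA.mem_accepts
  refine h.trans ?_
  refine exists_congr fun q => and_congr_right fun _ => ?_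
  rw [nfa_run]
  simp [M]

/-- Local condition on a word bordered by `none`. -/
def Local {Y : Type} (R : Option Y → Option Y → Prop) (l : List Y) : Prop :=
  R none l[0]? ∧ ∀ i, i < l.length → R l[i]? l[i + 1]?

theorem local_run_aux {Y : Type} (R : Option Y → Option Y → Prop) (l : List Y) (p : Option Y) :
    (∃ q ∈ {q | R q none}, Run (fun p y q => q = some y ∧ R p (some y)) p l q) ↔
      R p l[0]? ∧ ∀ i, i < l.length → R l[i]? l[i + 1]? := by
  induction l generalizing p with
  | nil => simp [Run]
  | cons y l ih =>
    have : (∃ q ∈ {q | R q none}, Run (fun p y q => q = some y ∧ R p (some y)) p (y :: l) q) ↔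
        R p (some y) ∧
        (∃ q ∈ {q | R q none}, Run (fun p y q => q = some y ∧ R p (some y)) (some y) l q) := by
      simp only [Run]
      constructor
      · rintro ⟨q, hq, _, ⟨rfl, h⟩, hr⟩
        exact ⟨h, q, hq, hr⟩
      · rintro ⟨h, q, hq, hr⟩
        exact ⟨q, hq, _, ⟨rfl, h⟩, hr⟩
    rw [this, ih]
    refine and_congr (by simp) ?_
    constructor
    · rintro ⟨h0, hi⟩ i h
      cases i with
      | zero => simpa using h0
      | succ i => simpa using hi i (by simpa using h)
    · intro hi
      refine ⟨by simpa using hi 0 (by simp), fun i h => ?_⟩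
      simpa using hi (i + 1) (by simpa using h)

theorem local_run {Y : Type} (R : Option Y → Option Y → Prop) (l : List Y) :
    (∃ q ∈ {q | R q none}, Run (fun p y q => q = some y ∧ R p (some y)) none l q) ↔
      Local R l := local_run_aux R l none

theorem regular_local {Y : Type} [Fintype Y] (R : Option Y → Option Y → Prop) :
    Regular {u | Local R u} := by
  have := regular_of_run (fun p y q => q = some y ∧ R p (some y)) none {q | R q none}
  simpa only [local_run] using this

theorem path_iff {Γ : Type} (T : Transducer Γ) (hT : T.Synchronous) (q q' : T.Q)
    (ls : List (Option Γ × Option Γ)) :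
    T.Path q ls q' ↔ ∃ ps : List (Γ × Γ), ls = ps.map (fun p => (some p.1, some p.2)) ∧
      Run (fun q (p : Γ × Γ) q' => T.trans q (some p.1, some p.2) q') q ps q' := by
  constructor
  · intro h
    induction h with
    | nil q => exact ⟨[], rfl, rfl⟩
    | @cons q q' q'' l ls ht _ ih =>
      obtain ⟨ps, rfl, hr⟩ := ih
      obtain ⟨h1, h2⟩ := hT _ _ _ ht
      obtain ⟨l1, l2⟩ := l
      obtain ⟨x, rfl⟩ := Option.isSome_iff_exists.1 h1
      obtain ⟨y, rfl⟩ := Option.isSome_iff_exists.1 h2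
      exact ⟨(x, y) :: ps, rfl, q', ht, hr⟩
  · rintro ⟨ps, rfl, hr⟩
    induction ps generalizing q with
    | nil => cases hr; exact .nil _
    | cons p ps ih =>
      obtain ⟨p', h, hr⟩ := hr
      exact .cons h (ih _ hr)

theorem ins_map {Γ : Type} (ps : List (Γ × Γ)) :
    Transducer.ins (ps.map (fun p => (some p.1, some p.2))) = ps.map Prod.fst := by
  induction ps with
  | nil => rfl
  | cons p ps ih => simp_all [Transducer.ins]

theorem outs_map {Γ : Type} (ps : List (Γ × Γ)) :
    Transducer.outs (ps.map (fun p => (some p.1, some p.2))) = ps.map Prod.snd := by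
  induction ps with
  | nil => rfl
  | cons p ps ih => simp_all [Transducer.outs]

theorem accepts_iff {Γ : Type} (T : Transducer Γ) (hT : T.Synchronous) (u v : List Γ) :
    T.Accepts u v ↔ u.length = v.length ∧ ∃ q ∈ T.final,
      Run (fun q (p : Γ × Γ) q' => T.trans q (some p.1, some p.2) q') T.init (u.zip v) q := by
  constructor
  · rintro ⟨q, ls, hp, hq, rfl, rfl⟩
    obtain ⟨ps, rfl, hr⟩ := (path_iff T hT _ _ _).1 hp
    rw [ins_map, outs_map]
    refine ⟨by simp, q, hq, ?_⟩
    rwa [← List.unzip_fst, ← List.unzip_snd, List.zip_unzip]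
  · rintro ⟨hl, q, hq, hr⟩
    refine ⟨q, _, (path_iff T hT _ _ _).2 ⟨_, rfl, hr⟩, hq, ?_, ?_⟩
    · rw [ins_map, List.map_fst_zip hl.le]
    · rw [outs_map, List.map_snd_zip hl.ge]

/-- Vertex-function description of the path language. -/
theorem lang_iff {A Γ : Type} (G : RationalGraph A Γ) (I F : Set (List Γ)) (w : List A) :
    w ∈ G.Lang I F ↔ ∃ v : ℕ → List Γ, v 0 ∈ I ∧ v w.length ∈ F ∧
      ∀ j (h : j < w.length), G.Edge (v j) w[j] (v (j + 1)) := by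
  constructor
  · rintro ⟨vs, i, f, ⟨hl, hp⟩, hi, hI, hf, hF⟩
    refine ⟨fun j => vs[j]?.getD [], ?_, ?_, ?_⟩
    · rw [List.head?_eq_getElem?] at hi
      simpa [hi] using hI
    · rw [List.getLast?_eq_getElem?, hl] at hf
      simp only [Nat.add_sub_cancel] at hf
      simpa [hf] using hF
    · intro j h
      have h1 : j < vs.length := by omega
      have h2 : j + 1 < vs.length := by omega
      apply hp j <;> simp [h, h1, h2]
  · rintro ⟨v, hI, hF, hE⟩
    refine ⟨(List.range (w.length + 1)).map v, v 0, v w.length, ⟨by simp, ?_⟩, ?_, hI, ?_, hF⟩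
    · intro k a u u' hk hu hu'
      obtain ⟨h, rfl⟩ := List.getElem?_eq_some_iff.1 hk
      have h1 : k < w.length + 1 := by omega
      simp [h1, h] at hu hu'
      subst hu hu'
      exact hE k h
    · rw [List.head?_eq_getElem?]; simp
    · rw [List.getLast?_eq_getElem?]; simp

/-- Grid description of the word language of a tiling system. -/
def GridOK {A Λ : Type} (S : TilingSystem A Λ) (w : List A) (n : ℕ)
    (g : ℕ → ℕ → Option Λ) : Prop :=
  (∀ i j, (g i j).isSome ↔ 0 < i ∧ i ≤ n ∧ 0 < j ∧ j ≤ w.length) ∧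
  (∀ j (h : j < w.length), g 1 (j + 1) = some (S.emb w[j])) ∧
  (∀ i j, i ≤ n → j ≤ w.length →
    (⟨g i j, g i (j + 1), g (i + 1) j, g (i + 1) (j + 1)⟩ : Tile (Option Λ)) ∈ S.tiles)

theorem framed_get {Λ : Type} (rows : List (List Λ)) (m : ℕ) (hm : ∀ r ∈ rows, r.length = m)
    (g : ℕ → ℕ → Option Λ)
    (hg : ∀ i j, g i j = if 0 < i ∧ 0 < j then (rows[i - 1]?.getD [])[j - 1]? else none)
    (i : ℕ) :
    (framed rows m)[i]? = if i ≤ rows.length + 1 then some ((List.range (m + 2)).map (g i))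
      else none := by
  split_ifs with hi
  · rcases Nat.eq_zero_or_pos i with rfl | h0
    · simp only [framed, List.cons_append, List.getElem?_cons_zero]
      congr 1
      apply List.ext_getElem <;> simp [hg]
    · obtain ⟨i, rfl⟩ : ∃ k, i = k + 1 := ⟨i - 1, by omega⟩
      simp only [framed, List.cons_append, List.getElem?_cons_succ]
      by_cases h : i < rows.length
      · rw [List.getElem?_append_left (by simpa using h)]
        have hr := hm rows[i] (List.getElem_mem h)
        simp only [List.getElem?_map, List.getElem?_eq_getElem h, Option.map_some]
        congr 1
        apply List.ext_getElem
        · simp [hr]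
        · intro j h1 h2
          cases j with
          | zero => simp [hg]
          | succ j =>
            simp only [List.getElem_cons_succ, List.getElem_map, List.getElem_range, hg]
            by_cases hj : j < m
            · rw [List.getElem_append_left (by simp [hr, hj])]
              simp [h, hr, hj]
            · have : j = m := by simp [hr] at h1; omega
              subst this
              rw [List.getElem_append_right (by simp [hr])]
              simp [h, hr]
      · have : i = rows.length := by omega
        subst this
        rw [List.getElem?_append_right (by simp)]
        simp only [List.length_map, Nat.sub_self, List.getElem?_cons_zero]
        congr 1
        apply List.ext_getElem <;> simp [hg]
  · rw [List.getElem?_eq_none]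
    simp [framed]; omega

theorem tiling_lang_iff {A Λ : Type} (S : TilingSystem A Λ) (w : List A) :
    w ∈ S.Lang ↔ ∃ n, 0 < n ∧ 0 < w.length ∧ ∃ g, GridOK S w n g := by
  constructor
  · rintro ⟨rows, n, ⟨hn, hw, rfl, hr, ht⟩, hh⟩
    set g : ℕ → ℕ → Option Λ := fun i j =>
      if 0 < i ∧ 0 < j then (rows[i - 1]?.getD [])[j - 1]? else none with hg
    have hf := framed_get rows w.length hr g (fun i j => rfl)
    refine ⟨_, hn, hw, g, ?_, ?_, ?_⟩
    · intro i j
      simp only [hg]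
      split_ifs with h
      · by_cases hi : i - 1 < rows.length
        · have hr' := hr _ (List.getElem_mem hi)
          simp [hi, hr']; omega
        · have hnone : rows[i - 1]? = none := List.getElem?_eq_none (by omega)
          simp [hnone]; omega
      · simp; omega
    · intro j h
      rw [List.head?_eq_getElem?] at hh
      simp [hg, hh, h]
    · intro i j hi hj
      apply ht
      refine ⟨i, j, (List.range (w.length + 2)).map (g i),
        (List.range (w.length + 2)).map (g (i + 1)), ?_, ?_, ?_, ?_, ?_, ?_⟩
      · rw [hf, if_pos (by omega)]
      · rw [hf, if_pos (by omega)]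
      all_goals
        rw [List.getElem?_map, List.getElem?_range (by omega)]
        rfl
  · rintro ⟨n, hn, hw, g, h1, h2, h3⟩
    have hsome : ∀ i j, i < n → j < w.length → ∃ x, g (i + 1) (j + 1) = some x := by
      intro i j hi hj
      exact Option.isSome_iff_exists.1 ((h1 _ _).2 ⟨by omega, by omega, by omega, by omega⟩)
    obtain ⟨x0, _⟩ := hsome 0 0 hn hw
    have : ∀ i j, ∃ x, i < n → j < w.length → g (i + 1) (j + 1) = some x := by
      intro i j
      by_cases hi : i < n
      · by_cases hj : j < w.length
        · obtain ⟨x, hx⟩ := hsome i j hi hj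
          exact ⟨x, fun _ _ => hx⟩
        · exact ⟨x0, fun _ h => absurd h hj⟩
      · exact ⟨x0, fun h => absurd h hi⟩
    choose d hd using this
    set rows := (List.range n).map (fun i => (List.range w.length).map (d i)) with hrows
    have hr : ∀ r ∈ rows, r.length = w.length := by
      intro r hr
      obtain ⟨i, _, rfl⟩ := List.mem_map.1 hr
      simp
    have hnl : rows.length = n := by simp [hrows]
    have hg : ∀ i j, g i j = if 0 < i ∧ 0 < j then (rows[i - 1]?.getD [])[j - 1]? else none := by
      intro i j
      have hnone : ¬ (0 < i ∧ i ≤ n ∧ 0 < j ∧ j ≤ w.length) → g i j = none := by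
        intro h
        rw [← h1] at h
        simpa using h
      split_ifs with h
      · obtain ⟨i, rfl⟩ : ∃ k, i = k + 1 := ⟨i - 1, by omega⟩
        obtain ⟨j, rfl⟩ : ∃ k, j = k + 1 := ⟨j - 1, by omega⟩
        by_cases hi : i < n
        · by_cases hj : j < w.length
          · simp [hrows, hi, hj, hd]
          · rw [hnone (by omega)]
            simp [hrows, hi, hj]
        · rw [hnone (by omega)]
          simp [hrows, hi]
      · exact hnone (by omega)
    have hf := framed_get rows w.length hr g hg
    refine ⟨rows, n, ⟨hn, hw, hnl, hr, ?_⟩, ?_⟩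
    · rintro t ⟨i, j, r₁, r₂, e1, e2, e3, e4, e5, e6⟩
      rw [hf] at e1 e2
      have hi : i ≤ n := by
        by_contra h
        rw [if_neg (by omega)] at e2
        cases e2
      rw [if_pos (by omega)] at e1 e2
      cases e1
      cases e2
      have hj : j ≤ w.length := by
        by_contra h
        rw [List.getElem?_eq_none (by simp; omega)] at e4
        cases e4
      rw [List.getElem?_map, List.getElem?_range (by omega)] at e3 e4 e5 e6
      have := h3 i j hi hj
      cases t
      simp at e3 e4 e5 e6
      subst e3 e4 e5 e6
      exact this
    · rw [List.head?_eq_getElem?]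
      simp only [hrows, List.getElem?_map, List.getElem?_range hn, Option.map_some]
      congr 1
      apply List.ext_getElem
      · simp
      · intro j e1 e2
        have e3 : j < w.length := by simpa using e1
        have := hd 0 j hn e3
        rw [h2 j e3] at this
        simpa using this.symm


/-- A column (with border) read as a function. -/
def col {Λ : Type} (u : List (Option Λ)) : ℕ → Option Λ
  | 0 => none
  | i + 1 => u[i]?.join

theorem local_iff {Y : Type} (R : Option Y → Option Y → Prop) (l : List Y) :
    Local R l ↔ ∀ i, i ≤ l.length →
      R (if i = 0 then none else l[i - 1]?) l[i]? := by
  constructor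
  · rintro ⟨h0, h⟩ i hi
    cases i with
    | zero => simpa using h0
    | succ i => simpa using h i (by omega)
  · intro h
    refine ⟨by simpa using h 0 (by simp), fun i hi => ?_⟩
    simpa using h (i + 1) (by omega)

/-- Vertical constraint for final columns. -/
def RF {A Λ : Type} (S : TilingSystem A Λ) (p q : Option (Option Λ)) : Prop :=
  ¬ (p = none ∧ q = none) ∧ (∀ y, q = some y → y.isSome) ∧
    (⟨p.join, none, q.join, none⟩ : Tile (Option Λ)) ∈ S.tiles

/-- Vertical constraint for initial columns. -/
def RI {Λ : Type} (p q : Option (Option Λ)) : Prop :=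
  ¬ (p = none ∧ q = none) ∧ (∀ y, q = some y → y = none)

/-- Vertical constraint for pairs of columns. -/
def RT {A Λ : Type} (S : TilingSystem A Λ) (a : A) (p q : Option (Option Λ × Option Λ)) : Prop :=
  ¬ (p = none ∧ q = none) ∧ (∀ y, q = some y → y.2.isSome) ∧
    (∀ y, p = none → q = some y → y.2 = some (S.emb a)) ∧
    (⟨(p.map Prod.fst).join, (p.map Prod.snd).join,
      (q.map Prod.fst).join, (q.map Prod.snd).join⟩ : Tile (Option Λ)) ∈ S.tiles

theorem mem_RI {Λ : Type} (u : List (Option Λ)) :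
    Local RI u ↔ 0 < u.length ∧ ∀ i, col u i = none := by
  rw [local_iff]
  constructor
  · intro h
    have h0 := h 0 (by simp)
    constructor
    · rcases u with _ | ⟨x, u⟩
      · simp [RI] at h0
      · simp
    · intro i
      cases i with
      | zero => rfl
      | succ i =>
        simp only [col]
        by_cases hi : i < u.length
        · have := (h i hi.le).2 _ (List.getElem?_eq_getElem hi)
          simp [hi, this]
        · simp [List.getElem?_eq_none (not_lt.1 hi)]
  · rintro ⟨hl, h⟩ i hi
    refine ⟨?_, ?_⟩
    · rintro ⟨h1, h2⟩
      have : ¬ i < u.length := by simpa using h2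
      rw [if_neg (by omega)] at h1
      simp at h1
      omega
    · intro y hy
      have := h (i + 1)
      simp only [col, hy] at this
      simpa using this

theorem mem_RF {A Λ : Type} (S : TilingSystem A Λ) (u : List (Option Λ)) :
    Local (RF S) u ↔ 0 < u.length ∧ (∀ i, i < u.length → (col u (i + 1)).isSome) ∧
      ∀ i, i ≤ u.length → (⟨col u i, none, col u (i + 1), none⟩ : Tile (Option Λ)) ∈ S.tiles := by
  have hc : ∀ i, (if i = 0 then none else u[i - 1]?).join = col u i := by
    intro i
    cases i <;> simp [col]
  rw [local_iff]
  constructor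
  · intro h
    have h0 := h 0 (by simp)
    refine ⟨?_, ?_, ?_⟩
    · rcases u with _ | ⟨x, u⟩
      · simp [RF] at h0
      · simp
    · intro i hi
      have := (h i hi.le).2.1 _ (List.getElem?_eq_getElem hi)
      simp only [col, List.getElem?_eq_getElem hi]
      simpa using this
    · intro i hi
      have := (h i hi).2.2
      rwa [hc] at this
  · rintro ⟨hl, h, h'⟩ i hi
    refine ⟨?_, ?_, ?_⟩
    · rintro ⟨h1, h2⟩
      have : ¬ i < u.length := by simpa using h2
      rw [if_neg (by omega)] at h1
      simp at h1
      omega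
    · intro y hy
      obtain ⟨hi', rfl⟩ := List.getElem?_eq_some_iff.1 hy
      have := h i hi'
      simp only [col, hy] at this
      simpa using this
    · rw [hc]
      exact h' i hi

theorem mem_RT {A Λ : Type} (S : TilingSystem A Λ) (a : A) (u v : List (Option Λ))
    (huv : u.length = v.length) :
    Local (RT S a) (u.zip v) ↔ 0 < v.length ∧ (∀ i, i < v.length → (col v (i + 1)).isSome) ∧
      col v 1 = some (S.emb a) ∧
      ∀ i, i ≤ v.length →
        (⟨col u i, col v i, col u (i + 1), col v (i + 1)⟩ : Tile (Option Λ)) ∈ S.tiles := by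
  have hlen : (u.zip v).length = v.length := by simp [huv]
  have h1 : ∀ i : ℕ, ((u.zip v)[i]?.map Prod.fst) = u[i]? := by
    intro i
    rw [← List.getElem?_map, List.map_fst_zip huv.le]
  have h2 : ∀ i : ℕ, ((u.zip v)[i]?.map Prod.snd) = v[i]? := by
    intro i
    rw [← List.getElem?_map, List.map_snd_zip huv.ge]
  have hc1 : ∀ i, ((if i = 0 then none else (u.zip v)[i - 1]?).map Prod.fst).join = col u i := by
    intro i
    cases i
    · simp [col]
    · simp only [Nat.add_one_ne_zero, if_false, Nat.add_sub_cancel, h1, col]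
  have hc2 : ∀ i, ((if i = 0 then none else (u.zip v)[i - 1]?).map Prod.snd).join = col v i := by
    intro i
    cases i
    · simp [col]
    · simp only [Nat.add_one_ne_zero, if_false, Nat.add_sub_cancel, h2, col]
  rw [local_iff, hlen]
  constructor
  · intro h
    have h0 := h 0 (by simp)
    have hpos : 0 < v.length := by
      by_contra hn
      apply h0.1
      refine ⟨rfl, List.getElem?_eq_none (by omega)⟩
    have hget : ∀ (i : ℕ) (hi : i < v.length),
        (u.zip v)[i]? = some (u[i]'(by omega), v[i]) := by
      intro i hi
      rw [List.getElem?_eq_getElem (by omega)]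
      simp
    refine ⟨hpos, ?_, ?_, ?_⟩
    · intro i hi
      have := (h i hi.le).2.1 _ (hget i hi)
      simp only [col, List.getElem?_eq_getElem hi]
      simpa using this
    · have := h0.2.2.1 _ rfl (hget 0 hpos)
      simp only [col, List.getElem?_eq_getElem hpos]
      simpa using this
    · intro i hi
      have := (h i hi).2.2.2
      rwa [hc1, hc2, h1, h2] at this
  · rintro ⟨hl, h, ha, h'⟩ i hi
    have key : ∀ y, (u.zip v)[i]? = some y → y.2 = col v (i + 1) ∧ i < v.length := by
      intro y hy
      have := h2 i
      rw [hy] at this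
      have h3 := this.symm
      obtain ⟨hi', _⟩ := List.getElem?_eq_some_iff.1 h3
      refine ⟨?_, hi'⟩
      simp only [col, h3]
      rfl
    refine ⟨?_, ?_, ?_, ?_⟩
    · rintro ⟨e1, e2⟩
      rw [List.getElem?_eq_none_iff] at e2
      rw [if_neg (by omega), List.getElem?_eq_none_iff] at e1
      omega
    · intro y hy
      rw [(key y hy).1]
      exact h i (key y hy).2
    · intro y e hy
      rw [(key y hy).1]
      have : i = 0 := by
        by_contra hne
        rw [if_neg hne, List.getElem?_eq_none_iff] at e
        omega
      subst this
      exact ha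
    · rw [hc1, hc2, h1, h2]
      exact h' i hi

/-- The transducer for the letter `a`. -/
def tr {A Λ : Type} [Fintype Λ] (S : TilingSystem A Λ) (a : A) : Transducer (Option Λ) where
  Q := Option (Option Λ × Option Λ)
  fintypeQ := inferInstance
  init := none
  final := {q | RT S a q none}
  trans := fun p l q => ∃ x y, l = (some x, some y) ∧ q = some (x, y) ∧ RT S a p (some (x, y))

theorem tr_sync {A Λ : Type} [Fintype Λ] (S : TilingSystem A Λ) (a : A) :
    (tr S a).Synchronous := by
  rintro q q' l ⟨x, y, rfl, _⟩
  exact ⟨rfl, rfl⟩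

theorem tr_accepts {A Λ : Type} [Fintype Λ] (S : TilingSystem A Λ) (a : A)
    (u v : List (Option Λ)) :
    (tr S a).Accepts u v ↔ u.length = v.length ∧ Local (RT S a) (u.zip v) := by
  rw [accepts_iff _ (tr_sync S a), ← local_run]
  refine and_congr_right fun _ => ?_
  have : (fun (q : (tr S a).Q) (p : Option Λ × Option Λ) (q' : (tr S a).Q) =>
      (tr S a).trans q (some p.1, some p.2) q') =
      fun p y q => q = some y ∧ RT S a p (some y) := by
    funext q p q'
    apply propext
    constructor
    · rintro ⟨x, y, e, h⟩
      simp only [Prod.mk.injEq, Option.some.injEq] at e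
      obtain ⟨rfl, rfl⟩ := e
      exact h
    · intro h
      exact ⟨p.1, p.2, rfl, h⟩
  rw [this]
  rfl

theorem tiling_to_graph {A Λ : Type} [Fintype Λ] (S : TilingSystem A Λ) :
    ∃ (Γ : Type) (_ : Fintype Γ) (G : RationalGraph A Γ) (I F : Set (List Γ)),
        G.Synchronous ∧ Regular I ∧ Regular F ∧ G.Lang I F = S.Lang := by
  refine ⟨Option Λ, inferInstance, ⟨tr S⟩, {u | Local RI u}, {u | Local (RF S) u},
    tr_sync S, regular_local _, regular_local _, ?_⟩
  apply Set.ext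
  intro w
  rw [lang_iff, tiling_lang_iff]
  simp only [Set.mem_ofPred_eq, RationalGraph.Edge, mem_RI, mem_RF, tr_accepts]
  constructor
  · rintro ⟨v, ⟨hpos, hI⟩, ⟨_, hF, hFt⟩, hE⟩
    have hlen : ∀ j, j ≤ w.length → (v j).length = (v 0).length := by
      intro j
      induction j with
      | zero => simp
      | succ j ih =>
        intro h
        rw [← ih (by omega), (hE j (by omega)).1]
    have hw : 0 < w.length := by
      by_contra h
      have h0 : w.length = 0 := by omega
      rw [h0] at hF
      have := hF 0 hpos
      rw [hI] at this
      simp at this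
    have hE' : ∀ j (h : j < w.length), _ := fun j h => (mem_RT S _ _ _ (hE j h).1).1 (hE j h).2
    have hbot : ∀ j, j ≤ w.length → ∀ i, (v 0).length < i → col (v j) i = none := by
      intro j hj i hi
      obtain ⟨i, rfl⟩ : ∃ k, i = k + 1 := ⟨i - 1, by omega⟩
      simp only [col]
      rw [List.getElem?_eq_none (by rw [hlen j hj]; omega)]
      rfl
    refine ⟨(v 0).length, hpos, hw, fun i j => if j ≤ w.length then col (v j) i else none,
      ?_, ?_, ?_⟩
    · intro i j
      beta_reduce
      split_ifs with h
      · cases j with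
        | zero => simp [hI]
        | succ j =>
          cases i with
          | zero => simp [col]
          | succ i =>
            by_cases hi : i < (v 0).length
            · have := (hE' j h).2.1 i (by rw [hlen _ h]; exact hi)
              simp [this]; omega
            · rw [hbot _ h _ (by omega)]
              simp; omega
      · simp; omega
    · intro j h
      beta_reduce
      rw [if_pos (by omega)]
      exact (hE' j h).2.2.1
    · intro i j hi hj
      rcases Nat.lt_or_ge j w.length with h | h
      · simp only [if_pos hj, if_pos (show j + 1 ≤ w.length from h)]
        exact (hE' j h).2.2.2 i (by rw [hlen _ h]; exact hi)
      · have : j = w.length := by omega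
        subst this
        simp only [le_refl, if_true, if_neg (show ¬ w.length + 1 ≤ w.length by omega)]
        exact hFt i (by rw [hlen _ le_rfl]; exact hi)
  · rintro ⟨n, hn, hw, g, h1, h2, h3⟩
    have hnone : ∀ i j, ¬ (0 < i ∧ i ≤ n ∧ 0 < j ∧ j ≤ w.length) → g i j = none := by
      intro i j h
      rw [← h1] at h
      simpa using h
    let v : ℕ → List (Option Λ) := fun j => (List.range n).map (fun i => g (i + 1) j)
    have hl : ∀ j, (v j).length = n := by intro j; simp [v]
    have hc : ∀ i j, col (v j) i = g i j := by
      intro i j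
      cases i with
      | zero => rw [hnone _ _ (by omega)]; rfl
      | succ i =>
        simp only [col, v]
        by_cases hi : i < n
        · simp [hi]
        · rw [hnone _ _ (by omega)]
          simp [hi]
    refine ⟨v, ⟨?_, ?_⟩, ⟨?_, ?_, ?_⟩, ?_⟩
    · rw [hl]; exact hn
    · intro i
      rw [hc, hnone _ _ (by omega)]
    · rw [hl]; exact hn
    · intro i hi
      rw [hl] at hi
      rw [hc, h1]
      omega
    · intro i hi
      rw [hl] at hi
      have := h3 i w.length hi le_rfl
      rw [hnone i (w.length + 1) (by omega), hnone (i + 1) (w.length + 1) (by omega)] at this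
      rw [hc, hc]
      exact this
    · intro j hj
      have e : (v j).length = (v (j + 1)).length := by rw [hl, hl]
      refine ⟨e, (mem_RT S _ _ _ e).2 ⟨?_, ?_, ?_, ?_⟩⟩
      · rw [hl]; exact hn
      · intro i hi
        rw [hl] at hi
        rw [hc, h1]
        omega
      · rw [hc]; exact h2 j hj
      · intro i hi
        rw [hl] at hi
        simp only [hc]
        exact h3 i j hi hj.le


/-- Uniform data extracted from a synchronous graph and two automata. -/
structure Dat (A Q Γ P R : Type) where
  ini : A → Q
  fin : Set Q
  tr : Q → Γ → Γ → Q → Prop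
  sI : P
  stI : P → Γ → P
  accI : Set P
  sF : R
  stF : R → Γ → R
  accF : Set R

/-- A run of the data over the word `w`, of height `N`. -/
structure Good {A Q Γ P R : Type} (D : Dat A Q Γ P R) (w : List A) (N : ℕ)
    (v : ℕ → ℕ → Γ) (r : ℕ → ℕ → Q) (s : ℕ → P) (t : ℕ → R) : Prop where
  r0 : ∀ j (h : j < w.length), r j 0 = D.ini w[j]
  rN : ∀ j, j < w.length → r j N ∈ D.fin
  rs : ∀ j i, j < w.length → i < N → D.tr (r j i) (v j i) (v (j + 1) i) (r j (i + 1))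
  s0 : s 0 = D.sI
  sN : s N ∈ D.accI
  ss : ∀ i, i < N → s (i + 1) = D.stI (s i) (v 0 i)
  t0 : t 0 = D.sF
  tN : t N ∈ D.accF
  ts : ∀ i, i < N → t (i + 1) = D.stF (t i) (v w.length i)

theorem graph_data {A Γ : Type} [Finite A] (G : RationalGraph A Γ) (hG : G.Synchronous) :
    ∃ (Q : Type) (_ : Finite Q) (ini : A → Q) (fin : Set Q) (tr : Q → Γ → Γ → Q → Prop),
      ∀ u a v, G.Edge u a v ↔ u.length = v.length ∧ ∃ r : ℕ → Q, r 0 = ini a ∧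
        r u.length ∈ fin ∧
        ∀ i (h : i < u.length) (h' : i < v.length), tr (r i) u[i] v[i] (r (i + 1)) := by
  have hfin : ∀ a, Finite (G.trans a).Q := fun a => @Finite.of_fintype _ (G.trans a).fintypeQ
  refine ⟨Σ a, (G.trans a).Q, inferInstance, fun a => ⟨a, (G.trans a).init⟩,
    {q | q.2 ∈ (G.trans q.1).final},
    fun q x y q' => ∃ a p p', q = ⟨a, p⟩ ∧ q' = ⟨a, p'⟩ ∧
      (G.trans a).trans p (some x, some y) p', ?_⟩
  intro u a v
  rw [RationalGraph.Edge, accepts_iff _ (hG a)]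
  refine and_congr_right fun hl => ?_
  have hz : (u.zip v).length = u.length := by simp [hl]
  constructor
  · rintro ⟨q, hq, hr⟩
    obtain ⟨s, h0, hN, hs⟩ := (run_iff _ _ _ _).1 hr
    refine ⟨fun i => ⟨a, s i⟩, by simp [h0], ?_, ?_⟩
    · rw [hz] at hN
      change s u.length ∈ (G.trans a).final
      rw [hN]
      exact hq
    · intro i h h'
      have := hs i (by omega)
      simp only [List.getElem_zip] at this
      exact ⟨a, _, _, rfl, rfl, this⟩
  · rintro ⟨r, h0, hN, hs⟩
    have hex : ∀ i, i ≤ u.length → ∃ p, r i = ⟨a, p⟩ := by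
      intro i
      induction i with
      | zero => intro _; exact ⟨_, h0⟩
      | succ i ih =>
        intro hi
        obtain ⟨p, hp⟩ := ih (by omega)
        obtain ⟨a', p1, p2, e1, e2, _⟩ := hs i (by omega) (by omega)
        rw [hp] at e1
        have : a = a' := congrArg Sigma.fst e1
        subst this
        exact ⟨_, e2⟩
    have hex' : ∀ i, ∃ p, i ≤ u.length → r i = ⟨a, p⟩ := by
      intro i
      by_cases hi : i ≤ u.length
      · obtain ⟨p, hp⟩ := hex i hi
        exact ⟨p, fun _ => hp⟩
      · exact ⟨(G.trans a).init, fun h => absurd h hi⟩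
    choose s hs' using hex'
    have hinj : ∀ p p' : (G.trans a).Q,
        (⟨a, p⟩ : Σ a, (G.trans a).Q) = ⟨a, p'⟩ → p = p' := by
      intro p p' h
      simpa using h
    refine ⟨s u.length, ?_, (run_iff _ _ _ _).2 ⟨s, ?_, by rw [hz], ?_⟩⟩
    · rw [hs' _ le_rfl] at hN
      exact hN
    · rw [hs' 0 (by omega)] at h0
      exact hinj _ _ h0
    · intro i hi
      rw [hz] at hi
      obtain ⟨a', p1, p2, e1, e2, h⟩ := hs i hi (by omega)
      rw [hs' i (by omega)] at e1
      rw [hs' (i + 1) (by omega)] at e2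
      have : a = a' := congrArg Sigma.fst e1
      subst this
      rw [← hinj _ _ e1, ← hinj _ _ e2] at h
      simpa only [List.getElem_zip] using h

theorem graph_good {A Γ : Type} [Finite A] (G : RationalGraph A Γ) (hG : G.Synchronous)
    (I F : Set (List Γ)) (hI : Regular I) (hF : Regular F) (hne : [] ∉ G.Lang I F) :
    ∃ (Q P R : Type) (_ : Finite Q) (_ : Finite P) (_ : Finite R) (D : Dat A Q Γ P R),
      ∀ w, w ∈ G.Lang I F ↔ 0 < w.length ∧ ∃ N, 0 < N ∧ ∃ v r s t, Good D w N v r s t := by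
  obtain ⟨Q, hQ, ini, fin, tr, hE⟩ := graph_data G hG
  obtain ⟨P, hP, sI, stI, accI, hI'⟩ := regular_run hI
  obtain ⟨R, hR, sF, stF, accF, hF'⟩ := regular_run hF
  have hdisj : ∀ u, u ∈ I → u ∉ F := by
    intro u h1 h2
    apply hne
    rw [lang_iff]
    exact ⟨fun _ => u, h1, h2, fun j h => by simp at h⟩
  refine ⟨Q, P, R, hQ, inferInstance, inferInstance,
    ⟨ini, fin, tr, sI, stI, accI, sF, stF, accF⟩, fun w => ?_⟩
  constructor
  · intro hw
    have hwpos : 0 < w.length := by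
      rcases w with _ | ⟨a, w⟩
      · exact absurd hw hne
      · simp
    refine ⟨hwpos, ?_⟩
    obtain ⟨v, h0, hm, he⟩ := (lang_iff _ _ _ _).1 hw
    have hlen : ∀ j, j ≤ w.length → (v j).length = (v 0).length := by
      intro j
      induction j with
      | zero => simp
      | succ j ih =>
        intro h
        rw [← ih (by omega), ((hE _ _ _).1 (he j (by omega))).1]
    have hpos : 0 < (v 0).length := by
      by_contra hn
      have e0 : v 0 = [] := List.length_eq_zero_iff.1 (by omega)
      have e1 : v w.length = [] := List.length_eq_zero_iff.1 (by rw [hlen _ le_rfl]; omega)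
      rw [e0] at h0
      rw [e1] at hm
      exact hdisj _ h0 hm
    let x0 : Γ := (v 0)[0]
    obtain ⟨s, s0, sN, ss⟩ := (hI' _).1 h0
    obtain ⟨t, t0, tN, ts⟩ := (hF' _).1 hm
    obtain ⟨q0, -⟩ : ∃ q : Q, True := ⟨ini w[0], trivial⟩
    have hr : ∀ j, ∃ r : ℕ → Q, ∀ h : j < w.length, r 0 = ini w[j] ∧
        r (v j).length ∈ fin ∧
        ∀ i (h : i < (v j).length) (h' : i < (v (j + 1)).length),
          tr (r i) (v j)[i] (v (j + 1))[i] (r (i + 1)) := by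
      intro j
      by_cases h : j < w.length
      · obtain ⟨r, hr⟩ := ((hE _ _ _).1 (he j h)).2
        exact ⟨r, fun _ => hr⟩
      · exact ⟨fun _ => q0, fun h' => absurd h' h⟩
    choose r hr using hr
    have hg : ∀ j, j ≤ w.length → ∀ i, i < (v 0).length → ∃ h : i < (v j).length,
        (v j)[i]?.getD x0 = (v j)[i] := by
      intro j hj i hi
      have : i < (v j).length := by rw [hlen j hj]; exact hi
      exact ⟨this, by simp [this]⟩
    refine ⟨(v 0).length, hpos, fun j i => (v j)[i]?.getD x0, r, s, t, ?_⟩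
    constructor
    · exact fun j h => (hr j h).1
    · intro j h
      have := (hr j h).2.1
      rwa [hlen j h.le] at this
    · intro j i hj hi
      obtain ⟨h1, e1⟩ := hg j hj.le i hi
      obtain ⟨h2, e2⟩ := hg (j + 1) hj i hi
      simp only [e1, e2]
      exact (hr j hj).2.2 i h1 h2
    · exact s0
    · exact sN
    · intro i hi
      obtain ⟨h1, e1⟩ := hg 0 (by omega) i hi
      simp only [e1]
      exact ss i hi
    · exact t0
    · rwa [hlen _ le_rfl] at tN
    · intro i hi
      obtain ⟨h1, e1⟩ := hg _ le_rfl i hi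
      simp only [e1]
      exact ts i h1
  · rintro ⟨hwpos, N, hN, v, r, s, t, h⟩
    rw [lang_iff]
    refine ⟨fun j => (List.range N).map (v j), ?_, ?_, ?_⟩
    · refine (hI' _).2 ⟨s, h.s0, by simpa using h.sN, ?_⟩
      intro i hi
      simpa using h.ss i (by simpa using hi)
    · refine (hF' _).2 ⟨t, h.t0, by simpa using h.tN, ?_⟩
      intro i hi
      simpa using h.ts i (by simpa using hi)
    · intro j hj
      refine (hE _ _ _).2 ⟨by simp, r j, h.r0 j hj, by simpa using h.rN j hj, ?_⟩
      intro i hi hi'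
      simpa using h.rs j i hj (by simpa using hi)

/-- Cells of the pictures simulating a graph. -/
structure Cell (Q Γ P R : Type) where
  q : Q
  q' : Q
  x : Γ
  y : Γ
  s : P
  s' : P
  t : R
  t' : R

theorem cell_finite {Q Γ P R : Type} [Finite Q] [Finite Γ] [Finite P] [Finite R] :
    Finite (Cell Q Γ P R) := by
  apply Finite.of_injective (β := Q × Q × Γ × Γ × P × P × R × R)
    (fun c => (c.q, c.q', c.x, c.y, c.s, c.s', c.t, c.t'))
  rintro ⟨⟩ ⟨⟩ h
  simpa using h

/-- Vertical dominoes. -/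
def VV {A Q Γ P R : Type} (D : Dat A Q Γ P R) :
    Option (A ⊕ Cell Q Γ P R) → Option (A ⊕ Cell Q Γ P R) → Prop
  | none, none => True
  | none, some (Sum.inl _) => True
  | some (Sum.inl a), some (Sum.inr d) =>
      d.q = D.ini a ∧ d.s = D.sI ∧ d.t = D.sF ∧ D.tr d.q d.x d.y d.q'
  | some (Sum.inr d), some (Sum.inr e) =>
      e.q = d.q' ∧ e.s = d.s' ∧ e.t = d.t' ∧ D.tr e.q e.x e.y e.q'
  | some (Sum.inr d), none => d.q' ∈ D.fin ∧ d.s' ∈ D.accI ∧ d.t' ∈ D.accF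
  | _, _ => False

/-- Horizontal dominoes. -/
def HH {A Q Γ P R : Type} (D : Dat A Q Γ P R) :
    Option (A ⊕ Cell Q Γ P R) → Option (A ⊕ Cell Q Γ P R) → Prop
  | none, some (Sum.inr d) => d.s' = D.stI d.s d.x
  | some (Sum.inr d), none => d.t' = D.stF d.t d.y
  | some (Sum.inr d), some (Sum.inr e) =>
      e.x = d.y ∧ e.s = d.s ∧ e.s' = d.s' ∧ e.t = d.t ∧ e.t' = d.t'
  | _, _ => True

/-- The tiling system simulating a graph. -/
def sys {A Q Γ P R : Type} (D : Dat A Q Γ P R) : TilingSystem A (A ⊕ Cell Q Γ P R) where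
  emb := Sum.inl
  emb_inj := Sum.inl_injective
  tiles := {t | HH D t.tl t.tr ∧ HH D t.bl t.br ∧ VV D t.tl t.bl ∧ VV D t.tr t.br}

/-- The grid of a run. -/
def grd {A C : Type} (w : List A) (N : ℕ) (d : ℕ → ℕ → C) : ℕ → ℕ → Option (A ⊕ C)
  | 0, _ => none
  | _ + 1, 0 => none
  | 1, j + 1 => w[j]?.map Sum.inl
  | i + 2, j + 1 => if i < N ∧ j < w.length then some (Sum.inr (d i j)) else none

theorem good_to_grid {A Q Γ P R : Type} (D : Dat A Q Γ P R) (w : List A) (hw : 0 < w.length)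
    (N : ℕ) (hN : 0 < N) (v : ℕ → ℕ → Γ) (r : ℕ → ℕ → Q) (s : ℕ → P) (t : ℕ → R)
    (h : Good D w N v r s t) : w ∈ (sys D).Lang := by
  rw [tiling_lang_iff]
  let d : ℕ → ℕ → Cell Q Γ P R := fun i j =>
    ⟨r j i, r j (i + 1), v j i, v (j + 1) i, s i, s (i + 1), t i, t (i + 1)⟩
  have hV : ∀ i j, i ≤ N + 1 → VV D (grd w N d i j) (grd w N d (i + 1) j) := by
    intro i j hi
    cases j with
    | zero => cases i <;> simp [grd, VV]
    | succ j =>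
      by_cases hj : j < w.length
      · match i, hi with
        | 0, _ => simp [grd, hj, VV]
        | 1, _ =>
          simp only [grd, hj, hN, and_self, if_true, List.getElem?_eq_getElem, Option.map_some, VV]
          exact ⟨h.r0 j hj, h.s0, h.t0, h.rs j 0 hj hN⟩
        | i + 2, hi =>
          have h1 : i < N := by omega
          by_cases h2 : i + 1 < N
          · simp only [grd, hj, h1, h2, and_self, if_true, VV]
            exact ⟨rfl, rfl, rfl, h.rs j (i + 1) hj h2⟩
          · have h3 : i + 1 = N := by omega
            simp only [grd, hj, h1, h2, and_self, if_true, false_and, if_false, VV]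
            simp only [d, h3]
            exact ⟨h.rN j hj, h.sN, h.tN⟩
      · match i, hi with
        | 0, _ => simp [grd, hj, VV]
        | 1, _ => simp [grd, hj, VV]
        | i + 2, hi => simp [grd, hj, VV]
  have hH : ∀ i j, j ≤ w.length → HH D (grd w N d i j) (grd w N d i (j + 1)) := by
    intro i j hj
    match i with
    | 0 => simp [grd, HH]
    | 1 =>
      cases j with
      | zero => simp [grd, hw, HH]
      | succ j =>
        have h1 : j < w.length := by omega
        by_cases h2 : j + 1 < w.length
        · simp [grd, h1, h2, HH]
        · simp [grd, h1, h2, HH]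
    | i + 2 =>
      by_cases hi : i < N
      · cases j with
        | zero =>
          simp only [grd, hw, hi, and_self, if_true, HH]
          exact h.ss i hi
        | succ j =>
          have h1 : j < w.length := by omega
          by_cases h2 : j + 1 < w.length
          · simp [grd, hi, h1, h2, HH, d]
          · have h3 : j + 1 = w.length := by omega
            simp only [grd, hi, h1, h2, and_self, if_true, and_false, if_false, HH]
            simp only [d, h3]
            exact h.ts i hi
      · cases j <;> simp [grd, hi, HH]
  refine ⟨N + 1, by omega, hw, grd w N d, ?_, ?_, ?_⟩
  · intro i j
    match i, j with
    | 0, j => simp [grd]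
    | i + 1, 0 => simp [grd]
    | 1, j + 1 =>
      simp [grd]
    | i + 2, j + 1 =>
      simp only [grd]
      split_ifs with h'
      · simp; omega
      · simp; omega
  · intro j hj
    simp [grd, hj, sys]
  · intro i j hi hj
    by_cases hj' : j < w.length
    all_goals exact ⟨hH i j hj, hH (i + 1) j hj, hV i j hi, hV i (j + 1) hi⟩

theorem grid_to_good {A Q Γ P R : Type} (D : Dat A Q Γ P R) (w : List A)
    (h : w ∈ (sys D).Lang) :
    0 < w.length ∧ ∃ N, 0 < N ∧ ∃ v r s t, Good D w N v r s t := by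
  rw [tiling_lang_iff] at h
  obtain ⟨n, hn, hw, g, h1, h2, h3⟩ := h
  refine ⟨hw, ?_⟩
  have hV : ∀ i j, i ≤ n → j ≤ w.length → VV D (g i j) (g (i + 1) j) :=
    fun i j hi hj => (h3 i j hi hj).2.2.1
  have hH : ∀ i j, i ≤ n → j ≤ w.length → HH D (g i j) (g i (j + 1)) :=
    fun i j hi hj => (h3 i j hi hj).1
  have hnone : ∀ i j, ¬ (0 < i ∧ i ≤ n ∧ 0 < j ∧ j ≤ w.length) → g i j = none := by
    intro i j h
    rw [← h1] at h
    simpa using h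
  have hfirst : ∀ j (hj : j < w.length), g 1 (j + 1) = some (Sum.inl w[j]) := h2
  have hn2 : 1 < n := by
    by_contra hc
    have hv := hV 1 1 hn hw
    rw [hfirst 0 hw, hnone 2 1 (by omega)] at hv
    exact hv
  have hcell : ∀ i j, i < n - 1 → j < w.length →
      ∃ d, g (i + 2) (j + 1) = some (Sum.inr d) := by
    intro i j hi hj
    have hs : (g (i + 2) (j + 1)).isSome := (h1 _ _).2 (by omega)
    obtain ⟨z, hz⟩ := Option.isSome_iff_exists.1 hs
    have hs' : (g (i + 1) (j + 1)).isSome := (h1 _ _).2 (by omega)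
    obtain ⟨z', hz'⟩ := Option.isSome_iff_exists.1 hs'
    have hv := hV (i + 1) (j + 1) (by omega) (by omega)
    rw [hz, hz'] at hv
    rcases z with a | d
    · rcases z' with a' | d'
      · exact absurd hv (by simp [VV])
      · exact absurd hv (by simp [VV])
    · exact ⟨d, hz⟩
  obtain ⟨d0, -⟩ := hcell 0 0 (by omega) hw
  have hex : ∀ i j, ∃ d, i < n - 1 → j < w.length → g (i + 2) (j + 1) = some (Sum.inr d) := by
    intro i j
    by_cases hi : i < n - 1
    · by_cases hj : j < w.length
      · obtain ⟨x, hx⟩ := hcell i j hi hj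
        exact ⟨x, fun _ _ => hx⟩
      · exact ⟨d0, fun _ h => absurd h hj⟩
    · exact ⟨d0, fun h => absurd h hi⟩
  choose d hd using hex
  obtain ⟨N, rfl⟩ : ∃ N, n = N + 1 := ⟨n - 1, by omega⟩
  simp only [Nat.add_sub_cancel] at hd
  have hN : 0 < N := by omega
  have v0 : ∀ j (hj : j < w.length), (d 0 j).q = D.ini w[j] ∧ (d 0 j).s = D.sI ∧
      (d 0 j).t = D.sF ∧ D.tr (d 0 j).q (d 0 j).x (d 0 j).y (d 0 j).q' := by
    intro j hj
    have hv := hV 1 (j + 1) (by omega) hj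
    rw [hfirst j hj, hd 0 j hN hj] at hv
    exact hv
  have v1 : ∀ i j, i + 1 < N → j < w.length → (d (i + 1) j).q = (d i j).q' ∧
      (d (i + 1) j).s = (d i j).s' ∧ (d (i + 1) j).t = (d i j).t' ∧
      D.tr (d (i + 1) j).q (d (i + 1) j).x (d (i + 1) j).y (d (i + 1) j).q' := by
    intro i j hi hj
    have hv := hV (i + 2) (j + 1) (by omega) hj
    rw [hd i j (by omega) hj, hd (i + 1) j hi hj] at hv
    exact hv
  have v2 : ∀ j, j < w.length → (d (N - 1) j).q' ∈ D.fin ∧ (d (N - 1) j).s' ∈ D.accI ∧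
      (d (N - 1) j).t' ∈ D.accF := by
    intro j hj
    have hv := hV (N - 1 + 2) (j + 1) (by omega) hj
    rw [hd (N - 1) j (by omega) hj, hnone _ _ (by omega)] at hv
    exact hv
  have vt : ∀ i j, i < N → j < w.length →
      D.tr (d i j).q (d i j).x (d i j).y (d i j).q' := by
    intro i j hi hj
    cases i with
    | zero => exact (v0 j hj).2.2.2
    | succ i => exact (v1 i j hi hj).2.2.2
  have k0 : ∀ i, i < N → (d i 0).s' = D.stI (d i 0).s (d i 0).x := by
    intro i hi
    have hh := hH (i + 2) 0 (by omega) (by omega)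
    rw [hd i 0 hi hw, hnone _ _ (by omega)] at hh
    exact hh
  have k1 : ∀ i j, i < N → j + 1 < w.length → (d i (j + 1)).x = (d i j).y := by
    intro i j hi hj
    have hh := hH (i + 2) (j + 1) (by omega) (by omega)
    rw [hd i j hi (by omega), hd i (j + 1) hi hj] at hh
    exact hh.1
  have k2 : ∀ i, i < N → (d i (w.length - 1)).t' =
      D.stF (d i (w.length - 1)).t (d i (w.length - 1)).y := by
    intro i hi
    have hh := hH (i + 2) (w.length - 1 + 1) (by omega) (by omega)
    rw [hd i _ hi (by omega), hnone _ _ (by omega)] at hh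
    exact hh
  refine ⟨N, hN, fun j i => if j = 0 then (d i 0).x else (d i (j - 1)).y,
    fun j i => if i = 0 then (d 0 j).q else (d (i - 1) j).q',
    fun i => if i = 0 then (d 0 0).s else (d (i - 1) 0).s',
    fun i => if i = 0 then (d 0 (w.length - 1)).t else (d (i - 1) (w.length - 1)).t', ?_⟩
  have hx : ∀ j i, j < w.length → i < N →
      (if j = 0 then (d i 0).x else (d i (j - 1)).y) = (d i j).x := by
    intro j i hj hi
    cases j with
    | zero => rfl
    | succ j => simpa using (k1 i j hi hj).symm
  have hq : ∀ j i, j < w.length → i < N →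
      (if i = 0 then (d 0 j).q else (d (i - 1) j).q') = (d i j).q := by
    intro j i hj hi
    cases i with
    | zero => rfl
    | succ i => simpa using (v1 i j hi hj).1.symm
  have hs : ∀ i, i < N → (if i = 0 then (d 0 0).s else (d (i - 1) 0).s') = (d i 0).s := by
    intro i hi
    cases i with
    | zero => rfl
    | succ i => simpa using (v1 i 0 hi hw).2.1.symm
  have ht : ∀ i, i < N → (if i = 0 then (d 0 (w.length - 1)).t
      else (d (i - 1) (w.length - 1)).t') = (d i (w.length - 1)).t := by
    intro i hi
    cases i with
    | zero => rfl
    | succ i => simpa using (v1 i (w.length - 1) hi (by omega)).2.2.1.symm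
  constructor
  · intro j hj
    exact (v0 j hj).1
  · intro j hj
    simp only [if_neg hN.ne']
    exact (v2 j hj).1
  · intro j i hj hi
    simp only [hx j i hj hi, hq j i hj hi, Nat.add_one_ne_zero, if_false, Nat.add_sub_cancel]
    exact vt i j hi hj
  · exact (v0 0 hw).2.1
  · simp only [if_neg hN.ne']
    exact (v2 0 hw).2.1
  · intro i hi
    simp only [hs i hi, Nat.add_one_ne_zero, if_false, Nat.add_sub_cancel, if_true]
    exact k0 i hi
  · exact (v0 (w.length - 1) (by omega)).2.2.1
  · simp only [if_neg hN.ne']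
    exact (v2 (w.length - 1) (by omega)).2.2
  · intro i hi
    simp only [ht i hi, Nat.add_one_ne_zero, if_false, Nat.add_sub_cancel, if_neg hw.ne']
    exact k2 i hi

theorem graph_to_tiling {A Γ : Type} [Fintype A] [Fintype Γ] (G : RationalGraph A Γ)
    (I F : Set (List Γ)) (hG : G.Synchronous) (hI : Regular I) (hF : Regular F)
    (hne : [] ∉ G.Lang I F) :
    ∃ (Λ : Type) (_ : Fintype Λ) (S : TilingSystem A Λ), S.Lang = G.Lang I F := by
  obtain ⟨Q, P, R, hQ, hP, hR, D, hD⟩ := graph_good G hG I F hI hF hne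
  have := cell_finite (Q := Q) (Γ := Γ) (P := P) (R := R)
  refine ⟨A ⊕ Cell Q Γ P R, Fintype.ofFinite _, sys D, ?_⟩
  apply Set.ext
  intro w
  rw [hD]
  constructor
  · exact grid_to_good D w
  · rintro ⟨hw, N, hN, v, r, s, t, h⟩
    exact good_to_grid D w hw N hN v r s t h

end SyncTiling

/-- A language `L` of nonempty words over a finite alphabet is accepted
by some synchronous rational graph between rational sets of initial and final vertices
iff `L` is the word language of some tiling system. -/
theorem synchronous_lang_iff_tiling {A : Type} [Fintype A]
    (L : Set (List A)) (hL : ∀ w ∈ L, w ≠ []) :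
    (∃ (Γ : Type) (_ : Fintype Γ) (G : RationalGraph A Γ) (I F : Set (List Γ)),
        G.Synchronous ∧ Regular I ∧ Regular F ∧ G.Lang I F = L) ↔
      (∃ (Λ : Type) (_ : Fintype Λ) (S : TilingSystem A Λ), S.Lang = L) := by
  constructor
  · rintro ⟨Γ, hΓ, G, I, F, hG, hI, hF, rfl⟩
    exact SyncTiling.graph_to_tiling G I F hG hI hF (fun h => hL _ h rfl)
  · rintro ⟨Λ, hΛ, S, rfl⟩
    exact SyncTiling.tiling_to_graph S
end

section
/- A language L of nonempty words over a finite alphabet Σ is accepted by some rational graph between rational sets of initial and final vertices if and only if L is the word language of some tiling system; that is, the languages accepted by rational graphs between rational sets of initial and final vertices are exactly the languages recognized by tiling systems (equivalently, the context-sensitive languages). -/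
section PartOne

variable {A Λ : Type}

/-- Adjacent columns are compatible with the tile set, given the letters above. -/
def colOK (Δ : Set (Tile (Option Λ))) :
    Option Λ → Option Λ → List (Option Λ) → List (Option Λ) → Prop
  | s, s', [], [] => (⟨s, s', none, none⟩ : Tile (Option Λ)) ∈ Δ
  | s, s', x :: u, y :: v => (⟨s, s', x, y⟩ : Tile (Option Λ)) ∈ Δ ∧ colOK Δ x y u v
  | _, _, _, _ => False

/-- Column-wise description of the language of a tiling system. -/
def TL (S : TilingSystem A Λ) : List A → List (Option Λ) → Prop
  | [], u => colOK S.tiles none none u (List.replicate u.length none)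
  | a :: w, u => ∃ v, colOK S.tiles none none u v ∧ v.head? = some (some (S.emb a)) ∧
      (∀ x ∈ v, x ≠ none) ∧ TL S w v

theorem colOK_iff (Δ : Set (Tile (Option Λ))) (u v : List (Option Λ)) (s s' : Option Λ) :
    colOK Δ s s' u v ↔ v.length = u.length ∧ ∀ i ≤ u.length,
      (⟨(s :: u)[i]?.getD none, (s' :: v)[i]?.getD none,
        u[i]?.getD none, v[i]?.getD none⟩ : Tile (Option Λ)) ∈ Δ := by
  induction u generalizing v s s' with
  | nil =>
    cases v with
    | nil => simp [colOK]
    | cons y v => simp [colOK]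
  | cons x u ih =>
    cases v with
    | nil => simp [colOK]
    | cons y v =>
      simp only [colOK, ih, List.length_cons, Nat.add_right_cancel_iff]
      constructor
      · rintro ⟨h0, hl, h⟩
        refine ⟨hl, ?_⟩
        rintro (_ | i) hi
        · simpa using h0
        · simpa using h i (by omega)
      · rintro ⟨hl, h⟩
        refine ⟨by simpa using h 0 (by omega), hl, fun i hi => by simpa using h (i + 1) (by omega)⟩

theorem TL_iff (S : TilingSystem A Λ) (w : List A) (u : List (Option Λ)) :
    TL S w u ↔ ∃ c : ℕ → List (Option Λ), c 0 = u ∧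
      (∀ j a, w[j]? = some a → colOK S.tiles none none (c j) (c (j + 1)) ∧
        (c (j + 1)).head? = some (some (S.emb a)) ∧ ∀ x ∈ c (j + 1), x ≠ none) ∧
      colOK S.tiles none none (c w.length) (List.replicate (c w.length).length none) := by
  induction w generalizing u with
  | nil =>
    simp only [TL]
    constructor
    · intro h
      exact ⟨fun _ => u, rfl, by simp, by simpa using h⟩
    · rintro ⟨c, rfl, -, h⟩
      simpa using h
  | cons a w ih =>
    simp only [TL]
    constructor
    · rintro ⟨v, h1, h2, h3, h4⟩
      obtain ⟨c, rfl, hc, hl⟩ := (ih v).1 h4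
      refine ⟨fun n => Nat.casesOn n u c, rfl, ?_, by simpa using hl⟩
      rintro (_ | j) b hb
      · simp at hb
        subst hb
        exact ⟨h1, h2, h3⟩
      · exact hc j b (by simpa using hb)
    · rintro ⟨c, rfl, hc, hl⟩
      have h0 := hc 0 a (by simp)
      refine ⟨c 1, h0.1, h0.2.1, h0.2.2, (ih _).2 ⟨fun n => c (n + 1), rfl, ?_, by simpa using hl⟩⟩
      intro j b hb
      exact hc (j + 1) b (by simpa using hb)

/-- The framed picture as a function on coordinates. -/
def gridOf (rows : List (List Λ)) : ℕ → ℕ → Option Λ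
  | i + 1, j + 1 => (rows[i]?).bind fun r => r[j]?
  | _, _ => none

theorem framed_eq (rows : List (List Λ)) (m : ℕ) (hm : ∀ r ∈ rows, r.length = m) :
    framed rows m = (List.range (rows.length + 2)).map fun i =>
      (List.range (m + 2)).map fun j => gridOf rows i j := by
  have hnone : ∀ i, (i = 0 ∨ rows.length < i) →
      (List.range (m + 2)).map (fun j => gridOf rows i j) = List.replicate (m + 2) none := by
    intro i hi
    rw [List.eq_replicate_iff]
    refine ⟨by simp, ?_⟩
    intro b hb
    simp only [List.mem_map] at hb
    obtain ⟨j, -, rfl⟩ := hb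
    rcases i with _ | i
    · simp [gridOf]
    · rcases j with _ | j
      · simp [gridOf]
      · have : rows[i]? = none := by
          rw [List.getElem?_eq_none_iff]; omega
        simp [gridOf, this]
  rw [List.range_succ (n := rows.length + 1), List.range_succ_eq_map (n := rows.length)]
  simp only [List.map_append, List.map_cons, List.map_nil, List.map_map, framed]
  rw [hnone 0 (Or.inl rfl), hnone (rows.length + 1) (Or.inr (by omega))]
  congr 2
  apply List.ext_getElem
  · simp
  intro i h1 h2
  simp only [List.length_map] at h1
  simp only [List.getElem_map, List.getElem_range, Function.comp]
  have hr := hm rows[i] (List.getElem_mem h1)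
  rw [List.range_succ, List.range_succ_eq_map]
  simp only [List.map_append, List.map_cons, List.map_nil, List.map_map]
  have e1 : gridOf rows (i + 1) 0 = none := rfl
  have e2 : gridOf rows (i + 1) (m + 1) = none := by
    simp [gridOf, List.getElem?_eq_getElem h1, hr]
  simp only [Nat.succ_eq_add_one, e1, e2, List.cons_append]
  congr 2
  apply List.ext_getElem
  · simp [hr]
  intro j h3 h4
  simp only [List.length_map] at h3
  simp [gridOf, List.getElem?_eq_getElem h1, List.getElem?_eq_getElem h3]

theorem tiles_framed (Δ : Set (Tile (Option Λ))) (rows : List (List Λ)) (m : ℕ)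
    (hm : ∀ r ∈ rows, r.length = m) :
    tilesOf (framed rows m) ⊆ Δ ↔ ∀ i ≤ rows.length, ∀ j ≤ m,
      (⟨gridOf rows i j, gridOf rows i (j + 1), gridOf rows (i + 1) j,
        gridOf rows (i + 1) (j + 1)⟩ : Tile (Option Λ)) ∈ Δ := by
  rw [framed_eq rows m hm]
  constructor
  · intro h i hi j hj
    apply h
    refine ⟨i, j, (List.range (m + 2)).map fun j => gridOf rows i j,
      (List.range (m + 2)).map fun j => gridOf rows (i + 1) j, ?_, ?_, ?_, ?_, ?_, ?_⟩
    · rw [List.getElem?_map, List.getElem?_range (by omega)]; rfl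
    · rw [List.getElem?_map, List.getElem?_range (by omega)]; rfl
    all_goals
      rw [List.getElem?_map, List.getElem?_range (by omega)]; rfl
  · rintro h ⟨tl, tr, bl, br⟩ ⟨i, j, r1, r2, h1, h2, h3, h4, h5, h6⟩
    simp only [List.getElem?_map, Option.map_eq_some_iff, List.getElem?_eq_some_iff,
      List.length_range, List.getElem_range] at h1 h2
    obtain ⟨i', ⟨hi, rfl⟩, rfl⟩ := h1
    obtain ⟨i', ⟨hi', rfl⟩, rfl⟩ := h2
    simp only [List.getElem?_map, Option.map_eq_some_iff, List.getElem?_eq_some_iff,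
      List.length_range, List.getElem_range] at h3 h4 h5 h6
    obtain ⟨_, ⟨_, rfl⟩, rfl⟩ := h3
    obtain ⟨_, ⟨_, rfl⟩, rfl⟩ := h4
    obtain ⟨_, ⟨_, rfl⟩, rfl⟩ := h5
    obtain ⟨_, ⟨_, rfl⟩, rfl⟩ := h6
    exact h _ (by omega) _ (by omega)

theorem tiling_lang_iff (S : TilingSystem A Λ) (w : List A) :
    w ∈ S.Lang ↔ w ≠ [] ∧ ∃ n, TL S w (List.replicate n none) := by
  constructor
  · rintro ⟨rows, n, ⟨hn, hm, rfl, hr, ht⟩, hw⟩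
    refine ⟨by rintro rfl; simp at hm, rows.length, ?_⟩
    rw [tiles_framed _ _ _ hr] at ht
    rw [TL_iff]
    have key : ∀ i j, (List.map (fun i => gridOf rows (i + 1) j)
        (List.range rows.length))[i]?.getD none = gridOf rows (i + 1) j := by
      intro i j
      rcases Nat.lt_or_ge i rows.length with h | h
      · simp [h]
      · have : rows[i]? = none := by simpa using h
        rcases j with _ | j
        · simp [gridOf, h]
        · simp [gridOf, h]
    have key2 : ∀ i j, (none :: List.map (fun i => gridOf rows (i + 1) j)
        (List.range rows.length))[i]?.getD none = gridOf rows i j := by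
      rintro (_ | i) j
      · simp [gridOf]
      · simpa using key i j
    have hcol : ∀ j ≤ w.length, colOK S.tiles none none
        ((List.range rows.length).map fun i => gridOf rows (i + 1) j)
        ((List.range rows.length).map fun i => gridOf rows (i + 1) (j + 1)) := by
      intro j hj
      rw [colOK_iff]
      refine ⟨by simp, fun i hi => ?_⟩
      rw [key, key, key2, key2]
      exact ht i (by simpa using hi) j hj
    refine ⟨fun j => (List.range rows.length).map fun i => gridOf rows (i + 1) j, ?_, ?_, ?_⟩
    · simp [gridOf]
    · intro j a hj
      have hj' : j < w.length := by
        by_contra hcon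
        rw [List.getElem?_eq_none (by omega)] at hj
        cases hj
      refine ⟨hcol j (by omega), ?_, ?_⟩
      · rw [List.head?_eq_getElem?, List.getElem?_map, List.getElem?_range hn]
        rw [List.head?_eq_getElem?] at hw
        simp [gridOf, hw, hj]
      · intro x hx
        simp only [List.mem_map, List.mem_range] at hx
        obtain ⟨i, hi, rfl⟩ := hx
        have := hr rows[i] (List.getElem_mem hi)
        have hj2 : j < rows[i].length := by omega
        simp [gridOf, List.getElem?_eq_getElem hi, List.getElem?_eq_getElem hj2]
    · have h := hcol w.length le_rfl
      have e : (List.range rows.length).map (fun i => gridOf rows (i + 1) (w.length + 1))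
          = List.replicate rows.length none := by
        rw [List.eq_replicate_iff]
        refine ⟨by simp, fun b hb => ?_⟩
        simp only [List.mem_map, List.mem_range] at hb
        obtain ⟨i, hi, rfl⟩ := hb
        have := hr rows[i] (List.getElem_mem hi)
        simp [gridOf, List.getElem?_eq_getElem hi, this]
      rw [e] at h
      simpa using h
  · rintro ⟨hw, n, h⟩
    rw [TL_iff] at h
    obtain ⟨c, hc0, hc, hl⟩ := h
    have hlen : ∀ j ≤ w.length, (c j).length = n := by
      intro j
      induction j with
      | zero => intro _; simp [hc0]
      | succ j ih =>
        intro hj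
        have h1 := (hc j w[j] (List.getElem?_eq_getElem (by omega))).1
        rw [colOK_iff] at h1
        rw [h1.1, ih (by omega)]
    have hm : 0 < w.length := List.length_pos_iff.2 hw
    have hn : 0 < n := by
      have h1 := (hc 0 w[0] (List.getElem?_eq_getElem (by omega))).2.1
      rw [← hlen 1 (by omega)]
      by_contra hcon
      have : c 1 = [] := List.length_eq_zero_iff.1 (by omega)
      rw [this] at h1
      simp at h1
    let d : Λ := S.emb w[0]
    let rows : List (List Λ) := (List.range n).map fun i => (List.range w.length).map fun j =>
      ((c (j + 1))[i]?.getD none).getD d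
    have hrl : rows.length = n := by simp [rows]
    have hr : ∀ r ∈ rows, r.length = w.length := by
      intro r hr
      simp only [rows, List.mem_map] at hr
      obtain ⟨i, -, rfl⟩ := hr
      simp
    have hg : ∀ i j, i < n → j < w.length →
        gridOf rows (i + 1) (j + 1) = (c (j + 1))[i]?.getD none := by
      intro i j hi hj
      have h1 := (hc j w[j] (List.getElem?_eq_getElem (by omega))).2.2
      have hi2 : i < (c (j + 1)).length := by rw [hlen (j + 1) (by omega)]; exact hi
      have h2 := h1 _ (List.getElem_mem hi2)
      obtain ⟨x, hx⟩ := Option.ne_none_iff_exists'.1 h2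
      simp [gridOf, rows, hi, hj, List.getElem?_eq_getElem hi2, hx]
    have hg1 : ∀ i j, j < w.length →
        gridOf rows (i + 1) (j + 1) = (c (j + 1))[i]?.getD none := by
      intro i j hj
      rcases Nat.lt_or_ge i n with hi | hi
      · exact hg i j hi hj
      · rw [List.getElem?_eq_none (by rw [hlen (j + 1) (by omega)]; exact hi)]
        have : rows[i]? = none := by simp [hrl, hi]
        simp [gridOf, this]
    have hg2 : ∀ i j, j ≤ w.length →
        gridOf rows i j = (none :: c j)[i]?.getD none := by
      rintro (_ | i) (_ | j) hj
      · simp [gridOf]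
      · simp [gridOf]
      · simp only [gridOf, hc0, List.getElem?_cons_succ, List.getElem?_replicate]
        split <;> rfl
      · simpa using hg1 i j (by omega)
    have hg3 : ∀ i, gridOf rows i (w.length + 1) = none := by
      rintro (_ | i)
      · rfl
      · rcases h : rows[i]? with _ | r
        · simp [gridOf, h]
        · have := hr r (List.mem_of_getElem? h)
          simp [gridOf, h, this]
    refine ⟨rows, n, ⟨hn, hm, hrl, hr, ?_⟩, ?_⟩
    · rw [tiles_framed _ _ _ hr]
      intro i hi j hj
      rw [hrl] at hi
      rw [hg2 i j hj, hg2 (i + 1) j hj]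
      rcases Nat.lt_or_ge j w.length with hj' | hj'
      · rw [hg2 i (j + 1) hj', hg2 (i + 1) (j + 1) hj']
        have h1 := (hc j w[j] (List.getElem?_eq_getElem (by omega))).1
        rw [colOK_iff] at h1
        simpa using h1.2 i (by rw [hlen j hj]; exact hi)
      · obtain rfl : j = w.length := by omega
        rw [hg3, hg3]
        rw [colOK_iff] at hl
        have h2 := hl.2 i (by rw [hlen _ hj]; exact hi)
        have e1 : ∀ k l : ℕ, (List.replicate k (none : Option Λ))[l]?.getD none = none := by
          intro k l
          rw [List.getElem?_replicate]
          split <;> rfl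
        have e2 : (none :: List.replicate (c w.length).length (none : Option Λ))[i]?.getD none
            = none := by
          rw [← List.replicate_succ]; exact e1 _ _
        rw [e1, e2] at h2
        simpa using h2
    · rw [List.head?_eq_getElem?]
      simp only [rows, List.getElem?_map, List.getElem?_range hn, Option.map_some]
      congr 1
      apply List.ext_getElem
      · simp
      intro j h1 h2
      simp only [List.length_map, List.length_range] at h1
      have h3 := (hc j w[j] (List.getElem?_eq_getElem (by omega))).2.1
      rw [List.head?_eq_getElem?] at h3
      simp [h3]

end PartOne

section PartTwo

variable {A Γ : Type}

/-- Recursive description of paths in a rational graph ending in `F`. -/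
def LP (G : RationalGraph A Γ) (F : Set (List Γ)) : List A → List Γ → Prop
  | [], u => u ∈ F
  | a :: w, u => ∃ v, G.Edge u a v ∧ LP G F w v

theorem isPath_cons (G : RationalGraph A Γ) (u v : List Γ) (vs : List (List Γ)) (a : A)
    (w : List A) :
    G.IsPath (u :: v :: vs) (a :: w) ↔ G.Edge u a v ∧ G.IsPath (v :: vs) w := by
  constructor
  · rintro ⟨hl, h⟩
    refine ⟨h 0 a u v (by simp) (by simp) (by simp), by simpa using hl, ?_⟩
    intro k b x y h1 h2 h3
    exact h (k + 1) b x y (by simpa using h1) (by simpa using h2) (by simpa using h3)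
  · rintro ⟨he, hl, h⟩
    refine ⟨by simpa using hl, ?_⟩
    rintro (_ | k) b x y h1 h2 h3
    · simp at h1 h2 h3
      subst h1 h2 h3
      exact he
    · exact h k b x y (by simpa using h1) (by simpa using h2) (by simpa using h3)

theorem LP_iff (G : RationalGraph A Γ) (F : Set (List Γ)) (w : List A) (u : List Γ) :
    LP G F w u ↔ ∃ vs f, G.IsPath (u :: vs) w ∧ (u :: vs).getLast? = some f ∧ f ∈ F := by
  induction w generalizing u with
  | nil =>
    simp only [LP]
    constructor
    · intro h
      exact ⟨[], u, ⟨by simp, by simp⟩, by simp, h⟩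
    · rintro ⟨vs, f, ⟨hl, -⟩, hf, h⟩
      have : vs = [] := by simpa using hl
      subst this
      simp at hf
      subst hf
      exact h
  | cons a w ih =>
    simp only [LP]
    constructor
    · rintro ⟨v, he, h⟩
      obtain ⟨vs, f, h1, h2, h3⟩ := (ih v).1 h
      exact ⟨v :: vs, f, (isPath_cons ..).2 ⟨he, h1⟩, by simpa using h2, h3⟩
    · rintro ⟨vs, f, h1, h2, h3⟩
      rcases vs with _ | ⟨v, vs⟩
      · have := h1.1
        simp at this
      · rw [isPath_cons] at h1
        exact ⟨v, h1.1, (ih v).2 ⟨vs, f, h1.2, by simpa using h2, h3⟩⟩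

theorem graph_lang_iff (G : RationalGraph A Γ) (I F : Set (List Γ)) (w : List A) :
    w ∈ G.Lang I F ↔ ∃ u ∈ I, LP G F w u := by
  constructor
  · rintro ⟨vs, i, f, h1, h2, h3, h4, h5⟩
    rcases vs with _ | ⟨v, vs⟩
    · simp at h2
    · simp at h2
      subst h2
      exact ⟨v, h3, (LP_iff ..).2 ⟨vs, f, h1, h4, h5⟩⟩
  · rintro ⟨u, hu, h⟩
    obtain ⟨vs, f, h1, h2, h3⟩ := (LP_iff ..).1 h
    exact ⟨u :: vs, u, f, h1, by simp, hu, h2, h3⟩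

theorem path_cons_iff (T : Transducer Γ) (q q'' : T.Q) (l : Option Γ × Option Γ)
    (ls : List (Option Γ × Option Γ)) :
    T.Path q (l :: ls) q'' ↔ ∃ q', T.trans q l q' ∧ T.Path q' ls q'' := by
  constructor
  · intro h
    cases h with
    | cons h1 h2 => exact ⟨_, h1, h2⟩
  · rintro ⟨q', h1, h2⟩
    exact .cons h1 h2

theorem path_nil_iff (T : Transducer Γ) (q q'' : T.Q) :
    T.Path q [] q'' ↔ q'' = q := by
  constructor
  · intro h
    cases h with
    | nil => rfl
  · rintro rfl
    exact .nil _

end PartTwo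

section TilingToGraph

variable {A Λ : Type}

/-- The transducer checking that two consecutive columns are compatible. -/
def colTrans [Fintype Λ] (S : TilingSystem A Λ) (a : A) : Transducer (Option Λ) where
  Q := Option Λ × Option Λ
  fintypeQ := inferInstance
  init := (none, none)
  final := { s | s.2 ≠ none ∧ (⟨s.1, s.2, none, none⟩ : Tile (Option Λ)) ∈ S.tiles }
  trans s l t := l = (some t.1, some t.2) ∧
    (⟨s.1, s.2, t.1, t.2⟩ : Tile (Option Λ)) ∈ S.tiles ∧ t.2 ≠ none ∧
    (s.2 = none → t.2 = some (S.emb a))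

theorem colTrans_run [Fintype Λ] (S : TilingSystem A Λ) (a : A) (u v : List (Option Λ))
    (s : Option Λ) (s' : Λ) :
    (∃ q ls, (colTrans S a).Path (s, some s') ls q ∧ q ∈ (colTrans S a).final ∧
      Transducer.ins ls = u ∧ Transducer.outs ls = v) ↔
    colOK S.tiles s (some s') u v ∧ ∀ x ∈ v, x ≠ none := by
  constructor
  · rintro ⟨q, ls, hp, hq, rfl, rfl⟩
    induction ls generalizing s s' with
    | nil =>
      have hp := (path_nil_iff _ _ _).1 hp
      subst hp
      exact ⟨hq.2, by simp [Transducer.outs]⟩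
    | cons l ls ih =>
      obtain ⟨⟨t, t'⟩, ⟨rfl, h1, h2, -⟩, h3⟩ := (path_cons_iff _ _ _ _ _).1 hp
      simp only at h1 h2
      obtain ⟨t', rfl⟩ := Option.ne_none_iff_exists'.1 h2
      have := ih _ _ h3
      exact ⟨⟨h1, this.1⟩, by simpa [Transducer.outs] using this.2⟩
  · rintro ⟨h, hv⟩
    induction u generalizing v s s' with
    | nil =>
      cases v with
      | nil => exact ⟨(s, some s'), [], .nil _, ⟨by simp, h⟩, rfl, rfl⟩
      | cons y v => exact h.elim
    | cons x u ih =>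
      cases v with
      | nil => exact h.elim
      | cons y v =>
        obtain ⟨y, rfl⟩ := Option.ne_none_iff_exists'.1 (hv y (by simp))
        obtain ⟨q, ls, h1, h2, h3, h4⟩ := ih v x y h.2 (fun z hz => hv z (by simp [hz]))
        refine ⟨q, (some x, some (some y)) :: ls,
          .cons (q' := ((x, some y) : Option Λ × Option Λ)) ⟨rfl, h.1, by simp, by simp⟩ h1, h2, ?_, ?_⟩
        · simpa [Transducer.ins] using h3
        · simpa [Transducer.outs] using h4

theorem colTrans_accepts [Fintype Λ] (S : TilingSystem A Λ) (a : A) (u v : List (Option Λ)) :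
    (colTrans S a).Accepts u v ↔ colOK S.tiles none none u v ∧
      v.head? = some (some (S.emb a)) ∧ ∀ x ∈ v, x ≠ none := by
  constructor
  · rintro ⟨q, ls, hp, hq, rfl, rfl⟩
    cases ls with
    | nil =>
      have hp := (path_nil_iff _ _ _).1 hp
      subst hp
      exact (hq.1 rfl).elim
    | cons l ls =>
      obtain ⟨⟨t, t'⟩, ⟨rfl, h1, h2, h4⟩, h3⟩ := (path_cons_iff _ _ _ _ _).1 hp
      have h4 : t' = _ := h4 rfl
      subst h4
      have := (colTrans_run S a _ _ t (S.emb a)).1 ⟨q, ls, h3, hq, rfl, rfl⟩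
      exact ⟨⟨h1, this.1⟩, by simp [Transducer.outs], by simpa [Transducer.outs] using this.2⟩
  · rintro ⟨h, hh, hv⟩
    cases v with
    | nil => simp at hh
    | cons y v =>
      simp at hh
      subst hh
      cases u with
      | nil => exact h.elim
      | cons x u =>
        obtain ⟨q, ls, h1, h2, h3, h4⟩ := (colTrans_run S a u v x (S.emb a)).2
          ⟨h.2, fun z hz => hv z (by simp [hz])⟩
        have hstep : (colTrans S a).trans ((none, none) : Option Λ × Option Λ)
            (some x, some (some (S.emb a))) ((x, some (S.emb a)) : Option Λ × Option Λ) :=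
          ⟨rfl, h.1, by simp, fun _ => rfl⟩
        refine ⟨q, (some x, some (some (S.emb a))) :: ls, .cons hstep h1, h2, ?_, ?_⟩
        · simpa [Transducer.ins] using h3
        · simpa [Transducer.outs] using h4

/-- Deterministic automaton for columns compatible with the right border;
the outer `none` is the sink state. -/
noncomputable def finDFA (S : TilingSystem A Λ) : DFA (Option Λ) (Option (Option Λ)) := by
  classical
  exact
  { step := fun s x => s.bind fun s =>
      if (⟨s, none, x, none⟩ : Tile (Option Λ)) ∈ S.tiles ∧ x ≠ none then some x else none
    start := some none
    accept := { s | ∃ x : Λ, s = some (some x) ∧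
      (⟨some x, none, none, none⟩ : Tile (Option Λ)) ∈ S.tiles } }

theorem finDFA_sink (S : TilingSystem A Λ) (u : List (Option Λ)) :
    (finDFA S).evalFrom none u = none := by
  induction u with
  | nil => rfl
  | cons x u ih => rw [DFA.evalFrom_cons]; exact ih

theorem finDFA_run (S : TilingSystem A Λ) (u : List (Option Λ)) (s : Λ) :
    (finDFA S).evalFrom (some (some s)) u ∈ (finDFA S).accept ↔
      (∀ x ∈ u, x ≠ none) ∧ colOK S.tiles (some s) none u (List.replicate u.length none) := by
  induction u generalizing s with
  | nil =>
    simp only [DFA.evalFrom_nil, finDFA, colOK, List.length_nil, List.replicate_zero]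
    simp
  | cons x u ih =>
    rw [DFA.evalFrom_cons]
    by_cases h : (⟨some s, none, x, none⟩ : Tile (Option Λ)) ∈ S.tiles ∧ x ≠ none
    · have : (finDFA S).step (some (some s)) x = some x := by
        simp only [finDFA, Option.bind_some]; rw [if_pos h]
      rw [this]
      obtain ⟨y, rfl⟩ := Option.ne_none_iff_exists'.1 h.2
      rw [ih]
      simp only [List.length_cons, List.replicate_succ, colOK, h.1, true_and]
      simp
    · have : (finDFA S).step (some (some s)) x = none := by
        simp only [finDFA, Option.bind_some]; rw [if_neg h]
      rw [this, finDFA_sink]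
      simp only [List.length_cons, List.replicate_succ, colOK]
      constructor
      · rintro ⟨y, hy, -⟩
        cases hy
      · rintro ⟨h1, h2, -⟩
        exact (h ⟨h2, h1 x (by simp)⟩).elim

theorem finDFA_accepts (S : TilingSystem A Λ) (u : List (Option Λ)) :
    u ∈ (finDFA S).accepts ↔ u ≠ [] ∧ (∀ x ∈ u, x ≠ none) ∧
      colOK S.tiles none none u (List.replicate u.length none) := by
  rw [DFA.mem_accepts]
  have hs : (finDFA S).start = some none := rfl
  rw [DFA.eval, hs]
  cases u with
  | nil =>
    simp only [DFA.evalFrom_nil, finDFA]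
    simp
  | cons x u =>
    rw [DFA.evalFrom_cons]
    by_cases h : (⟨none, none, x, none⟩ : Tile (Option Λ)) ∈ S.tiles ∧ x ≠ none
    · have : (finDFA S).step (some none) x = some x := by
        simp only [finDFA, Option.bind_some]; rw [if_pos h]
      rw [this]
      obtain ⟨y, rfl⟩ := Option.ne_none_iff_exists'.1 h.2
      rw [finDFA_run]
      simp only [List.length_cons, List.replicate_succ, colOK, h.1, true_and]
      simp
    · have : (finDFA S).step (some none) x = none := by
        simp only [finDFA, Option.bind_some]; rw [if_neg h]
      rw [this, finDFA_sink]
      simp only [List.length_cons, List.replicate_succ, colOK]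
      constructor
      · rintro ⟨y, hy, -⟩
        cases hy
      · rintro ⟨-, h1, h2, -⟩
        exact (h ⟨h2, h1 x (by simp)⟩).elim

theorem regular_replicate (Λ : Type) :
    Regular { u : List (Option Λ) | ∃ n, u = List.replicate n none } := by
  let M : DFA (Option Λ) Bool :=
    { step := fun b x => b && x.isNone, start := true, accept := {true} }
  refine ⟨Bool, inferInstance, M, ?_⟩
  have key : ∀ (u : List (Option Λ)) b, M.evalFrom b u = true ↔ b = true ∧ ∀ x ∈ u, x = none := by
    intro u
    induction u with
    | nil => intro b; simp
    | cons x u ih =>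
      intro b
      rw [DFA.evalFrom_cons, ih]
      simp [M, and_assoc]
  ext u
  have h1 : u ∈ M.accepts ↔ M.evalFrom true u = true := Iff.rfl
  rw [h1, key]
  simp only [true_and]
  constructor
  · intro h
    exact ⟨u.length, List.eq_replicate_iff.2 ⟨rfl, h⟩⟩
  · rintro ⟨n, rfl⟩ x hx
    exact List.eq_of_mem_replicate hx

/-- The columns compatible with the right border. -/
def finSet (S : TilingSystem A Λ) : Set (List (Option Λ)) :=
  { u | u ≠ [] ∧ (∀ x ∈ u, x ≠ none) ∧
      colOK S.tiles none none u (List.replicate u.length none) }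

theorem tiling_to_graph [Fintype Λ] (S : TilingSystem A Λ) :
    ∃ (Γ : Type) (_ : Fintype Γ) (G : RationalGraph A Γ) (I F : Set (List Γ)),
        Regular I ∧ Regular F ∧ G.Lang I F = S.Lang := by
  refine ⟨Option Λ, inferInstance, ⟨colTrans S⟩, { u | ∃ n, u = List.replicate n none },
    finSet S, regular_replicate Λ,
    ⟨_, inferInstance, finDFA S, Set.ext fun u => finDFA_accepts S u⟩, ?_⟩
  have key : ∀ (w : List A) (u : List (Option Λ)), u ≠ [] → (∀ x ∈ u, x ≠ none) →
      (LP ⟨colTrans S⟩ (finSet S) w u ↔ TL S w u) := by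
    intro w
    induction w with
    | nil =>
      intro u h1 h2
      simp only [LP, TL]
      exact ⟨fun h => h.2.2, fun h => ⟨h1, h2, h⟩⟩
    | cons a w ih =>
      intro u h1 h2
      simp only [LP, TL, RationalGraph.Edge, colTrans_accepts]
      constructor
      · rintro ⟨v, ⟨h3, h4, h5⟩, h6⟩
        exact ⟨v, h3, h4, h5, (ih v (by rintro rfl; simp at h4) h5).1 h6⟩
      · rintro ⟨v, h3, h4, h5, h6⟩
        exact ⟨v, ⟨h3, h4, h5⟩, (ih v (by rintro rfl; simp at h4) h5).2 h6⟩
  ext w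
  rw [graph_lang_iff, tiling_lang_iff]
  cases w with
  | nil =>
    simp only [LP, ne_eq, not_true_eq_false, false_and, iff_false]
    rintro ⟨u, ⟨n, rfl⟩, h⟩
    cases n with
    | zero => exact h.1 rfl
    | succ n => exact h.2.1 none (by simp) rfl
  | cons a w =>
    simp only [LP, TL, RationalGraph.Edge, colTrans_accepts]
    constructor
    · rintro ⟨u, ⟨n, rfl⟩, v, ⟨h3, h4, h5⟩, h6⟩
      exact ⟨by simp, n, v, h3, h4, h5, (key w v (by rintro rfl; simp at h4) h5).1 h6⟩
    · rintro ⟨-, n, v, h3, h4, h5, h6⟩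
      exact ⟨_, ⟨n, rfl⟩, v, ⟨h3, h4, h5⟩, (key w v (by rintro rfl; simp at h4) h5).2 h6⟩

end TilingToGraph

section Runs

variable {A Γ : Type}

/-- Runs of a labeled transition relation. -/
def Run {St L : Type} (step : St → L → St → Prop) : St → List L → St → Prop
  | s, [], e => e = s
  | s, l :: ls, e => ∃ s', step s l s' ∧ Run step s' ls e

/-- Transitions of a transducer, together with idle steps. -/
def padStep (T : Transducer Γ) (q : T.Q) (l : Option Γ × Option Γ) (q' : T.Q) : Prop :=
  T.trans q l q' ∨ (l = (none, none) ∧ q' = q)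

/-- Insertion of `none` letters. -/
inductive Exp {α : Type} : List (Option α) → List (Option α) → Prop
  | nil : Exp [] []
  | keep (a : Option α) {x y : List (Option α)} : Exp x y → Exp (a :: x) (a :: y)
  | ins {x y : List (Option α)} : Exp x y → Exp x (none :: y)

theorem Exp.refl {α : Type} (x : List (Option α)) : Exp x x := by
  induction x with
  | nil => exact .nil
  | cons a x ih => exact .keep a ih

theorem Exp.reduce {α : Type} {x y : List (Option α)} (h : Exp x y) :
    y.reduceOption = x.reduceOption := by
  induction h with
  | nil => rfl
  | keep a h ih => cases a <;> simp [ih]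
  | ins h ih => simpa using ih

theorem Exp.nil_of {α : Type} (y : List (Option α)) (h : y.reduceOption = []) : Exp [] y := by
  induction y with
  | nil => exact .nil
  | cons b y ih =>
    cases b with
    | none => exact .ins (ih (by simpa using h))
    | some b => simp at h

theorem common_exp {α : Type} (x y : List (Option α)) (h : x.reduceOption = y.reduceOption) :
    ∃ z, Exp x z ∧ Exp y z := by
  induction x generalizing y with
  | nil => exact ⟨y, Exp.nil_of y (by simpa using h.symm), Exp.refl y⟩
  | cons a x ih =>
    cases a with
    | none =>
      obtain ⟨z, h1, h2⟩ := ih y (by simpa using h)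
      exact ⟨none :: z, .keep _ h1, .ins h2⟩
    | some a =>
      induction y with
      | nil => simp at h
      | cons b y ihy =>
        cases b with
        | none =>
          obtain ⟨z, h1, h2⟩ := ihy (by simpa using h)
          exact ⟨none :: z, .ins h1, .keep _ h2⟩
        | some b =>
          simp only [List.reduceOption_cons_of_some, List.cons.injEq] at h
          obtain ⟨rfl, h⟩ := h
          obtain ⟨z, h1, h2⟩ := ih y h
          exact ⟨some a :: z, .keep _ h1, .keep _ h2⟩

theorem run_expand (T : Transducer Γ) {x x' : List (Option Γ)} (h : Exp x x') (q e : T.Q)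
    (ls : List (Option Γ × Option Γ)) (hx : ls.map Prod.fst = x)
    (hr : Run (padStep T) q ls e) :
    ∃ ls', ls'.map Prod.fst = x' ∧ Run (padStep T) q ls' e ∧
      Exp (ls.map Prod.snd) (ls'.map Prod.snd) := by
  induction h generalizing q ls with
  | nil => exact ⟨ls, hx, hr, Exp.refl _⟩
  | keep a h ih =>
    cases ls with
    | nil => simp at hx
    | cons l ls =>
      simp only [List.map_cons, List.cons.injEq] at hx
      obtain ⟨q', hs, hr⟩ := hr
      obtain ⟨ls', h1, h2, h3⟩ := ih q' ls hx.2 hr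
      exact ⟨l :: ls', by simp [h1, hx.1], ⟨q', hs, h2⟩, .keep _ h3⟩
  | ins h ih =>
    obtain ⟨ls', h1, h2, h3⟩ := ih q ls hx hr
    exact ⟨(none, none) :: ls', by simp [h1], ⟨q, Or.inr ⟨rfl, rfl⟩, h2⟩, .ins h3⟩

theorem path_to_run (T : Transducer Γ) (q e : T.Q) (ls : List (Option Γ × Option Γ))
    (h : T.Path q ls e) : Run (padStep T) q ls e := by
  induction h with
  | nil q => rfl
  | cons h1 h2 ih => exact ⟨_, Or.inl h1, ih⟩

theorem run_to_path (T : Transducer Γ) (q e : T.Q) (ls : List (Option Γ × Option Γ))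
    (h : Run (padStep T) q ls e) : ∃ ls', T.Path q ls' e ∧
      Transducer.ins ls' = (ls.map Prod.fst).reduceOption ∧
      Transducer.outs ls' = (ls.map Prod.snd).reduceOption := by
  induction ls generalizing q with
  | nil =>
    obtain rfl : e = q := h
    exact ⟨[], .nil _, rfl, rfl⟩
  | cons l ls ih =>
    obtain ⟨q', hs, hr⟩ := h
    obtain ⟨ls', h1, h2, h3⟩ := ih q' hr
    rcases hs with hs | ⟨rfl, rfl⟩
    · refine ⟨l :: ls', .cons hs h1, ?_, ?_⟩
      · obtain ⟨_ | x, y⟩ := l <;> simpa [Transducer.ins] using h2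
      · obtain ⟨x, _ | y⟩ := l <;> simpa [Transducer.outs] using h3
    · exact ⟨ls', h1, by simpa using h2, by simpa using h3⟩

theorem ins_eq (ls : List (Option Γ × Option Γ)) :
    Transducer.ins ls = (ls.map Prod.fst).reduceOption := by
  induction ls with
  | nil => rfl
  | cons l ls ih => obtain ⟨_ | x, y⟩ := l <;> simpa [Transducer.ins] using ih

theorem outs_eq (ls : List (Option Γ × Option Γ)) :
    Transducer.outs ls = (ls.map Prod.snd).reduceOption := by
  induction ls with
  | nil => rfl
  | cons l ls ih => obtain ⟨x, _ | y⟩ := l <;> simpa [Transducer.outs] using ih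

/-- Aligned (padded) paths. -/
def Al (G : RationalGraph A Γ) (F : Set (List Γ)) : List A → List (Option Γ) → Prop
  | [], x => x.reduceOption ∈ F
  | a :: w, x => ∃ ls e, ls.map Prod.fst = x ∧ Run (padStep (G.trans a)) (G.trans a).init ls e ∧
      e ∈ (G.trans a).final ∧ Al G F w (ls.map Prod.snd)

theorem Al_expand (G : RationalGraph A Γ) (F : Set (List Γ)) (w : List A)
    (x x' : List (Option Γ)) (h : Exp x x') (ha : Al G F w x) : Al G F w x' := by
  induction w generalizing x x' with
  | nil =>
    simp only [Al] at ha ⊢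
    rw [h.reduce]
    exact ha
  | cons a w ih =>
    obtain ⟨ls, e, h1, h2, h3, h4⟩ := ha
    obtain ⟨ls', h5, h6, h7⟩ := run_expand _ h _ _ ls h1 h2
    exact ⟨ls', e, h5, h6, h3, ih _ _ h7 h4⟩

theorem LP_iff_Al (G : RationalGraph A Γ) (F : Set (List Γ)) (w : List A) (u : List Γ) :
    LP G F w u ↔ ∃ x, x.reduceOption = u ∧ Al G F w x := by
  induction w generalizing u with
  | nil =>
    simp only [LP, Al]
    constructor
    · intro h
      have : (u.map some).reduceOption = u := by
        simp [List.reduceOption]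
      exact ⟨u.map some, this, by rwa [this]⟩
    · rintro ⟨x, rfl, h⟩
      exact h
  | cons a w ih =>
    simp only [LP]
    constructor
    · rintro ⟨v, ⟨e, ls, hp, he, rfl, rfl⟩, h0⟩
      obtain ⟨x, hx, h⟩ := (ih _).1 h0
      rw [outs_eq] at hx
      obtain ⟨z, hz1, hz2⟩ := common_exp _ _ hx
      have hsw : Run (padStep (G.trans a)) (G.trans a).init ls e := path_to_run _ _ _ _ hp
      obtain ⟨ls', h1, h2, h3⟩ : ∃ ls', ls'.map Prod.snd = z ∧
          Run (padStep (G.trans a)) (G.trans a).init ls' e ∧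
          Exp (ls.map Prod.fst) (ls'.map Prod.fst) := by
        clear hx ih hp h0
        generalize (G.trans a).init = q at hsw
        generalize hy : ls.map Prod.snd = y at hz2
        clear hz1
        induction hz2 generalizing q ls with
        | nil => exact ⟨ls, hy, hsw, Exp.refl _⟩
        | keep b h ih =>
          cases ls with
          | nil => simp at hy
          | cons l ls =>
            simp only [List.map_cons, List.cons.injEq] at hy
            obtain ⟨q', hs, hr⟩ := hsw
            obtain ⟨ls', h1, h2, h3⟩ := ih ls q' hr hy.2
            exact ⟨l :: ls', by simp [h1, hy.1], ⟨q', hs, h2⟩, .keep _ h3⟩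
        | ins h ih =>
          obtain ⟨ls', h1, h2, h3⟩ := ih ls q hsw hy
          exact ⟨(none, none) :: ls', by simp [h1], ⟨q, Or.inr ⟨rfl, rfl⟩, h2⟩, .ins h3⟩
      refine ⟨ls'.map Prod.fst, ?_, ls', e, rfl, h2, he, ?_⟩
      · rw [h3.reduce, ins_eq]
      · rw [h1]
        exact Al_expand _ _ _ _ _ hz1 h
    · rintro ⟨x, rfl, ls, e, rfl, h2, h3, h4⟩
      obtain ⟨ls', h5, h6, h7⟩ := run_to_path _ _ _ _ h2
      exact ⟨_, ⟨e, ls', h5, h3, h6, h7⟩, (ih _).2 ⟨_, rfl, h4⟩⟩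

end Runs

section Abstract

variable {A Γ St : Type}

/-- The state associated with a letter of the work alphabet. -/
def cellState (init : A → St) : A ⊕ (St × (Option Γ × Option Γ)) → St
  | .inl a => init a
  | .inr c => c.1

/-- Vertical compatibility. -/
def vertOK (step : St → Option Γ × Option Γ → St → Prop) (init : A → St) (fin : Set St) :
    Option (A ⊕ (St × (Option Γ × Option Γ))) →
    Option (A ⊕ (St × (Option Γ × Option Γ))) → Prop
  | none, _ => True
  | some p, none => cellState init p ∈ fin
  | some p, some (.inr d) => step (cellState init p) d.2 d.1
  | some _, some (.inl _) => False

/-- Horizontal compatibility. -/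
def horOK : Option (A ⊕ (St × (Option Γ × Option Γ))) →
    Option (A ⊕ (St × (Option Γ × Option Γ))) → Prop
  | some (.inr c), some (.inr d) => c.2.2 = d.2.1
  | _, _ => True

/-- The tiling system simulating an automaton running down each column. -/
def runTiling (step : St → Option Γ × Option Γ → St → Prop) (init : A → St)
    (fin finI finF : Set St) : TilingSystem A (A ⊕ (St × (Option Γ × Option Γ))) where
  emb := Sum.inl
  emb_inj := Sum.inl_injective
  tiles := { t | vertOK step init fin t.tl t.bl ∧ vertOK step init fin t.tr t.br ∧
    horOK t.bl t.br ∧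
    (t.tl = none → t.bl = none → t.br = none → ∀ p, t.tr = some p → cellState init p ∈ finI) ∧
    (t.tr = none → t.br = none → t.bl = none → ∀ p, t.tl = some p → cellState init p ∈ finF) }

/-- A run whose states are recorded in the cells. -/
def CRun (step : St → Option Γ × Option Γ → St → Prop) :
    St → List (St × (Option Γ × Option Γ)) → St → Prop
  | s, [], e => e = s
  | s, d :: ds, e => step s d.2 d.1 ∧ CRun step d.1 ds e

theorem CRun.run {step : St → Option Γ × Option Γ → St → Prop} {s e : St}
    {ds : List (St × (Option Γ × Option Γ))} (h : CRun step s ds e) :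
    Run step s (ds.map Prod.snd) e := by
  induction ds generalizing s with
  | nil => exact h
  | cons d ds ih => exact ⟨d.1, h.1, ih h.2⟩

theorem Run.crun {step : St → Option Γ × Option Γ → St → Prop} {s e : St}
    {ls : List (Option Γ × Option Γ)} (h : Run step s ls e) :
    ∃ ds : List (St × (Option Γ × Option Γ)), ds.map Prod.snd = ls ∧ CRun step s ds e := by
  induction ls generalizing s with
  | nil => exact ⟨[], rfl, h⟩
  | cons l ls ih =>
    obtain ⟨s', h1, h2⟩ := h
    obtain ⟨ds, h3, h4⟩ := ih h2
    exact ⟨(s', l) :: ds, by simp [h3], h1, h4⟩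

/-- The column of the picture consisting of the given cells. -/
def cellCol (ds : List (St × (Option Γ × Option Γ))) :
    List (Option (A ⊕ (St × (Option Γ × Option Γ)))) :=
  ds.map fun d => some (Sum.inr d)

variable (step : St → Option Γ × Option Γ → St → Prop) (init : A → St) (fin finI finF : Set St)

theorem col_left (k : ℕ) (v : List (Option (A ⊕ (St × (Option Γ × Option Γ)))))
    (p : A ⊕ (St × (Option Γ × Option Γ))) :
    (colOK (runTiling step init fin finI finF).tiles none (some p) (List.replicate k none) v ∧
      ∀ x ∈ v, x ≠ none) ↔
    ∃ ds e, ds.length = k ∧ v = cellCol ds ∧ CRun step (cellState init p) ds e ∧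
      e ∈ fin ∧ e ∈ finI := by
  induction k generalizing v p with
  | zero =>
    cases v with
    | nil =>
      simp only [List.replicate_zero, colOK]
      constructor
      · rintro ⟨⟨h1, h2, h3, h4, h5⟩, -⟩
        exact ⟨[], cellState init p, rfl, rfl, rfl, h2, h4 rfl rfl rfl p rfl⟩
      · rintro ⟨ds, e, h1, h2, h3, h4, h5⟩
        obtain rfl := List.length_eq_zero_iff.1 h1
        obtain rfl : e = _ := h3
        refine ⟨⟨trivial, h4, trivial, ?_, ?_⟩, by simp⟩
        · rintro - - - q hq
          cases hq
          exact h5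
        · intro h
          cases h
    | cons y v =>
      simp only [List.replicate_zero, colOK, false_and, false_iff]
      rintro ⟨ds, e, h1, h2, h3, h4, h5⟩
      obtain rfl := List.length_eq_zero_iff.1 h1
      cases h2
  | succ k ih =>
    cases v with
    | nil =>
      simp only [List.replicate_succ, colOK, false_and, false_iff]
      rintro ⟨ds, e, h1, h2, h3, h4, h5⟩
      cases ds with
      | nil => cases h1
      | cons d ds => cases h2
    | cons y v =>
      simp only [List.replicate_succ, colOK]
      constructor
      · rintro ⟨⟨⟨h1, h2, h3, h4, h5⟩, hc⟩, hv⟩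
        rcases y with _ | (a | d)
        · exact (hv none (by simp) rfl).elim
        · exact h2.elim
        · obtain ⟨ds, e, h6, rfl, h7, h8⟩ := (ih v (.inr d)).1
            ⟨hc, fun x hx => hv x (by simp [hx])⟩
          exact ⟨d :: ds, e, by simp [h6], rfl, ⟨h2, h7⟩, h8⟩
      · rintro ⟨ds, e, h1, h2, h3, h4, h5⟩
        cases ds with
        | nil => cases h1
        | cons d ds =>
          simp only [cellCol, List.map_cons, List.cons.injEq] at h2
          obtain ⟨rfl, h2⟩ := h2
          have := (ih v (.inr d)).2 ⟨ds, e, by simpa using h1, h2, h3.2, h4, h5⟩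
          refine ⟨⟨⟨trivial, h3.1, trivial, ?_, ?_⟩, this.1⟩, ?_⟩
          · intro _ _ h
            cases h
          · intro h
            cases h
          · intro x hx
            rcases List.mem_cons.1 hx with rfl | hx
            · simp
            · exact this.2 x hx

theorem col_mid (cs : List (St × (Option Γ × Option Γ)))
    (v : List (Option (A ⊕ (St × (Option Γ × Option Γ)))))
    (p p' : A ⊕ (St × (Option Γ × Option Γ))) (e : St)
    (hcs : CRun step (cellState init p) cs e) (he : e ∈ fin) :
    (colOK (runTiling step init fin finI finF).tiles (some p) (some p') (cellCol cs) v ∧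
      ∀ x ∈ v, x ≠ none) ↔
    ∃ ds e', (ds.map Prod.snd).map Prod.fst = (cs.map Prod.snd).map Prod.snd ∧ v = cellCol ds ∧
      CRun step (cellState init p') ds e' ∧ e' ∈ fin := by
  induction cs generalizing v p p' with
  | nil =>
    obtain rfl : e = _ := hcs
    cases v with
    | nil =>
      simp only [cellCol, List.map_nil, colOK]
      constructor
      · rintro ⟨⟨h1, h2, h3, h4, h5⟩, -⟩
        exact ⟨[], cellState init p', rfl, rfl, rfl, h2⟩
      · rintro ⟨ds, e, h1, h2, h3, h4⟩
        obtain rfl : ds = [] := by simpa using h1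
        obtain rfl : e = _ := h3
        refine ⟨⟨he, h4, trivial, ?_, ?_⟩, by simp⟩
        · intro h
          cases h
        · intro h
          cases h
    | cons y v =>
      simp only [cellCol, List.map_nil, colOK, false_and, false_iff]
      rintro ⟨ds, e, h1, h2, h3, h4⟩
      obtain rfl : ds = [] := by simpa using h1
      cases h2
  | cons c cs ih =>
    cases v with
    | nil =>
      simp only [cellCol, List.map_cons, colOK, false_and, false_iff]
      rintro ⟨ds, e, h1, h2, h3, h4⟩
      cases ds with
      | nil => cases h1
      | cons d ds => cases h2
    | cons y v =>
      simp only [cellCol, List.map_cons, colOK]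
      constructor
      · rintro ⟨⟨⟨h1, h2, h3, h4, h5⟩, hc⟩, hv⟩
        rcases y with _ | (a | d)
        · exact (hv none (by simp) rfl).elim
        · exact h2.elim
        · obtain ⟨ds, e, h6, rfl, h7, h8⟩ := (ih v (.inr c) (.inr d) hcs.2).1
            ⟨hc, fun x hx => hv x (by simp [hx])⟩
          have h3 : c.2.2 = d.2.1 := h3
          exact ⟨d :: ds, e, by simp only [List.map_cons, h6, h3], rfl, ⟨h2, h7⟩, h8⟩
      · rintro ⟨ds, e, h1, h2, h3, h4⟩
        cases ds with
        | nil => cases h1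
        | cons d ds =>
          simp only [List.map_cons, List.cons.injEq] at h1 h2
          obtain ⟨rfl, h2⟩ := h2
          have := (ih v (.inr c) (.inr d) hcs.2).2 ⟨ds, e, h1.2, h2, h3.2, h4⟩
          refine ⟨⟨⟨hcs.1, h3.1, h1.1.symm, ?_, ?_⟩, this.1⟩, ?_⟩
          · intro h
            cases h
          · intro h
            cases h
          · intro x hx
            rcases List.mem_cons.1 hx with rfl | hx
            · simp
            · exact this.2 x hx

theorem col_right (cs : List (St × (Option Γ × Option Γ)))
    (p : A ⊕ (St × (Option Γ × Option Γ))) (e : St)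
    (hcs : CRun step (cellState init p) cs e) (he : e ∈ fin) :
    colOK (runTiling step init fin finI finF).tiles (some p) none (cellCol cs)
      (List.replicate cs.length none) ↔ e ∈ finF := by
  induction cs generalizing p with
  | nil =>
    obtain rfl : e = _ := hcs
    simp only [cellCol, List.map_nil, colOK, List.length_nil, List.replicate_zero]
    constructor
    · rintro ⟨h1, h2, h3, h4, h5⟩
      exact h5 rfl rfl rfl p rfl
    · intro h
      refine ⟨he, trivial, trivial, ?_, ?_⟩
      · intro h
        cases h
      · rintro - - - q hq
        cases hq
        exact h
  | cons c cs ih =>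
    simp only [cellCol, List.map_cons, colOK, List.length_cons, List.replicate_succ]
    rw [← ih (.inr c) hcs.2]
    refine ⟨fun h => h.2, fun h => ⟨⟨hcs.1, trivial, trivial, ?_, ?_⟩, h⟩⟩
    · intro h
      cases h
    · intro _ _ h
      cases h

/-- Paths through columns of runs. -/
def AL : St → List (Option Γ) → List A → Prop
  | e, _, [] => e ∈ finF
  | _, y, a :: w => ∃ ls e', ls.map Prod.fst = y ∧ Run step (init a) ls e' ∧ e' ∈ fin ∧
      AL e' (ls.map Prod.snd) w

theorem TL_iff_AL (w : List A) (b : A) (cs : List (St × (Option Γ × Option Γ))) (e : St)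
    (hcs : CRun step (init b) cs e) (he : e ∈ fin) :
    TL (runTiling step init fin finI finF) w (some (Sum.inl b) :: cellCol cs) ↔
      AL step init fin finF e ((cs.map Prod.snd).map Prod.snd) w := by
  induction w generalizing b cs e with
  | nil =>
    simp only [TL, AL, List.length_cons, List.replicate_succ, colOK]
    have hl : (cellCol (A := A) cs).length = cs.length := by simp [cellCol]
    rw [hl, col_right step init fin finI finF cs (.inl b) e hcs he]
    refine ⟨fun h => h.2, fun h => ⟨⟨trivial, trivial, trivial, ?_, ?_⟩, h⟩⟩
    · intro _ h
      cases h
    · intro _ _ h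
      cases h
  | cons a w ih =>
    simp only [TL, AL]
    constructor
    · rintro ⟨v, h1, h2, h3, h4⟩
      cases v with
      | nil => cases h2
      | cons y v =>
        obtain rfl : y = some (Sum.inl a) := Option.some.inj h2
        obtain ⟨ds, e', h5, rfl, h6, h7⟩ := (col_mid step init fin finI finF cs v (.inl b)
          (.inl a) e hcs he).1 ⟨h1.2, fun x hx => h3 x (by simp [hx])⟩
        exact ⟨ds.map Prod.snd, e', h5, h6.run, h7, (ih a ds e' h6 h7).1 h4⟩
    · rintro ⟨ls, e', h1, h2, h3, h4⟩
      obtain ⟨ds, rfl, h5⟩ := h2.crun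
      have h6 := (col_mid step init fin finI finF cs (cellCol ds) (.inl b)
          (.inl a) e hcs he).2 ⟨ds, e', h1, rfl, h5, h3⟩
      refine ⟨some (Sum.inl a) :: cellCol ds, ⟨⟨trivial, trivial, trivial, ?_, ?_⟩, h6.1⟩, rfl, ?_,
        (ih a ds e' h5 h3).2 h4⟩
      · intro _ h
        cases h
      · intro _ h
        cases h
      · intro x hx
        rcases List.mem_cons.1 hx with rfl | hx
        · simp
        · exact h6.2 x hx

theorem runTiling_lang (w : List A) :
    w ∈ (runTiling step init fin finI finF).Lang ↔ ∃ a w', w = a :: w' ∧ ∃ ls e,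
      Run step (init a) ls e ∧ e ∈ fin ∧ e ∈ finI ∧
      AL step init fin finF e (ls.map Prod.snd) w' := by
  rw [tiling_lang_iff]
  cases w with
  | nil => simp
  | cons a w =>
    constructor
    · rintro ⟨-, n, v, h1, h2, h3, h4⟩
      cases v with
      | nil => cases h2
      | cons y v =>
        obtain rfl : y = some (Sum.inl a) := Option.some.inj h2
        cases n with
        | zero => exact h1.elim
        | succ n =>
          obtain ⟨ds, e, h5, rfl, h6, h7, h8⟩ := (col_left step init fin finI finF n v
            (.inl a)).1 ⟨h1.2, fun x hx => h3 x (by simp [hx])⟩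
          exact ⟨a, w, rfl, ds.map Prod.snd, e, h6.run, h7, h8,
            (TL_iff_AL step init fin finI finF w a ds e h6 h7).1 h4⟩
    · rintro ⟨a', w', h, ls, e, h1, h2, h3, h4⟩
      cases h
      obtain ⟨ds, rfl, h5⟩ := h1.crun
      have h6 := (col_left step init fin finI finF ds.length (cellCol ds)
          (.inl a)).2 ⟨ds, e, rfl, rfl, h5, h2, h3⟩
      refine ⟨by simp, ds.length + 1, some (Sum.inl a) :: cellCol ds,
        ⟨⟨trivial, trivial, trivial, ?_, ?_⟩, h6.1⟩, rfl, ?_,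
        (TL_iff_AL step init fin finI finF w a ds e h5 h2).2 h4⟩
      · rintro _ _ h
        cases h
      · intro _ h
        cases h
      · intro x hx
        rcases List.mem_cons.1 hx with rfl | hx
        · simp
        · exact h6.2 x hx

end Abstract

section GraphToTiling

variable {A Γ QI QF : Type}

/-- One step of a deterministic automaton on an optional letter. -/
def optStep {Q : Type} (M : DFA Γ Q) (s : Q) : Option Γ → Q
  | none => s
  | some x => M.step s x

/-- The product of the transducers with the automata for the initial and final vertices. -/
def prodStep (G : RationalGraph A Γ) (MI : DFA Γ QI) (MF : DFA Γ QF)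
    (s : (Σ a, (G.trans a).Q) × QI × QF) (l : Option Γ × Option Γ)
    (s' : (Σ a, (G.trans a).Q) × QI × QF) : Prop :=
  (∃ a q q', s.1 = ⟨a, q⟩ ∧ s'.1 = ⟨a, q'⟩ ∧ padStep (G.trans a) q l q') ∧
    s'.2.1 = optStep MI s.2.1 l.1 ∧ s'.2.2 = optStep MF s.2.2 l.2

theorem evalFrom_reduce {Q : Type} (M : DFA Γ Q) (s : Q) (x : Option Γ) (xs : List (Option Γ)) :
    M.evalFrom s (x :: xs).reduceOption = M.evalFrom (optStep M s x) xs.reduceOption := by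
  cases x <;> simp [optStep]

theorem run_prod (G : RationalGraph A Γ) (MI : DFA Γ QI) (MF : DFA Γ QF) (a : A)
    (q : (G.trans a).Q) (i : QI) (f : QF) (ls : List (Option Γ × Option Γ))
    (E : (Σ a, (G.trans a).Q) × QI × QF) :
    Run (prodStep G MI MF) (⟨a, q⟩, i, f) ls E ↔ ∃ e, Run (padStep (G.trans a)) q ls e ∧
      E = (⟨a, e⟩, MI.evalFrom i (ls.map Prod.fst).reduceOption,
        MF.evalFrom f (ls.map Prod.snd).reduceOption) := by
  induction ls generalizing q i f with
  | nil =>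
    constructor
    · intro h
      exact ⟨q, rfl, h⟩
    · rintro ⟨e, h1, h2⟩
      obtain rfl : e = q := h1
      exact h2
  | cons l ls ih =>
    simp only [Run, List.map_cons, evalFrom_reduce]
    constructor
    · rintro ⟨⟨⟨a', q'⟩, i', f'⟩, ⟨⟨a1, q1, q2, h1, h2, h3⟩, h4, h5⟩, hr⟩
      simp only at h1 h2 h4 h5
      cases h1
      cases h2
      subst h4 h5
      obtain ⟨e, h6, h7⟩ := (ih _ _ _).1 hr
      exact ⟨e, ⟨_, h3, h6⟩, h7⟩
    · rintro ⟨e, ⟨q', h1, h2⟩, h3⟩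
      exact ⟨(⟨a, q'⟩, optStep MI i l.1, optStep MF f l.2), ⟨⟨a, q, q', rfl, rfl, h1⟩, rfl, rfl⟩,
        (ih _ _ _).2 ⟨e, h2, h3⟩⟩

/-- Initial state of the product in the column labeled `a`. -/
def prodInit (G : RationalGraph A Γ) (MI : DFA Γ QI) (MF : DFA Γ QF) (a : A) :
    (Σ a, (G.trans a).Q) × QI × QF :=
  (⟨a, (G.trans a).init⟩, MI.start, MF.start)

theorem AL_iff_Al (G : RationalGraph A Γ) (MI : DFA Γ QI) (MF : DFA Γ QF) (F : Set (List Γ))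
    (hF : ∀ u, u ∈ F ↔ MF.evalFrom MF.start u ∈ MF.accept) (w : List A) (y : List (Option Γ))
    (E : (Σ a, (G.trans a).Q) × QI × QF) (hE : E.2.2 = MF.evalFrom MF.start y.reduceOption) :
    AL (prodStep G MI MF) (prodInit G MI MF) { s | s.1.2 ∈ (G.trans s.1.1).final }
      { s | s.2.2 ∈ MF.accept } E y w ↔ Al G F w y := by
  induction w generalizing y E with
  | nil =>
    simp only [AL, Al]
    rw [hF, ← hE]
    exact Iff.rfl
  | cons a w ih =>
    simp only [AL, Al]
    constructor
    · rintro ⟨ls, e, h1, h2, h3, h4⟩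
      obtain ⟨e', h5, rfl⟩ := (run_prod G MI MF a _ _ _ ls e).1 h2
      exact ⟨ls, e', h1, h5, h3, (ih _ _ rfl).1 h4⟩
    · rintro ⟨ls, e, h1, h2, h3, h4⟩
      exact ⟨ls, _, h1, (run_prod G MI MF a _ _ _ ls _).2 ⟨e, h2, rfl⟩, h3, (ih _ _ rfl).2 h4⟩

theorem graph_to_tiling [Fintype A] [Fintype Γ] (G : RationalGraph A Γ) (I F : Set (List Γ))
    (hI : Regular I) (hF : Regular F) (hne : ∀ w ∈ G.Lang I F, w ≠ []) :
    ∃ (Λ : Type) (_ : Fintype Λ) (S : TilingSystem A Λ), S.Lang = G.Lang I F := by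
  obtain ⟨QI, _, MI, hMI⟩ := hI
  obtain ⟨QF, _, MF, hMF⟩ := hF
  have hI : ∀ u, u ∈ I ↔ MI.evalFrom MI.start u ∈ MI.accept := by
    intro u
    rw [← hMI]
    exact Iff.rfl
  have hF : ∀ u, u ∈ F ↔ MF.evalFrom MF.start u ∈ MF.accept := by
    intro u
    rw [← hMF]
    exact Iff.rfl
  have : ∀ a, Fintype (G.trans a).Q := fun a => (G.trans a).fintypeQ
  refine ⟨A ⊕ (((Σ a, (G.trans a).Q) × QI × QF) × (Option Γ × Option Γ)), inferInstance,
    runTiling (prodStep G MI MF) (prodInit G MI MF) { s | s.1.2 ∈ (G.trans s.1.1).final }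
      { s | s.2.1 ∈ MI.accept } { s | s.2.2 ∈ MF.accept }, ?_⟩
  ext w
  rw [runTiling_lang]
  constructor
  · rintro ⟨a, w, rfl, ls, e, h1, h2, h3, h4⟩
    obtain ⟨e', h5, rfl⟩ := (run_prod G MI MF a _ _ _ ls e).1 h1
    have h6 := (AL_iff_Al G MI MF F hF w _ _ rfl).1 h4
    rw [graph_lang_iff]
    exact ⟨_, (hI _).2 h3, (LP_iff_Al ..).2 ⟨ls.map Prod.fst, rfl, ls, e', rfl, h5, h2, h6⟩⟩
  · intro hw
    have hw0 := hne w hw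
    cases w with
    | nil => exact (hw0 rfl).elim
    | cons a w =>
      rw [graph_lang_iff] at hw
      obtain ⟨u, hu, h⟩ := hw
      obtain ⟨x, rfl, ls, e, rfl, h1, h2, h3⟩ := (LP_iff_Al ..).1 h
      exact ⟨a, w, rfl, ls, _, (run_prod G MI MF a _ _ _ ls _).2 ⟨e, h1, rfl⟩, h2, (hI _).1 hu,
        (AL_iff_Al G MI MF F hF w _ _ rfl).2 h3⟩

end GraphToTiling

/-- A language `L` of nonempty words over a finite alphabet is accepted
by some rational graph between rational sets of initial and final vertices iff `L` is
the word language of some tiling system (i.e. is context-sensitive). -/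
theorem rational_lang_iff_tiling {A : Type} [Fintype A]
    (L : Set (List A)) (hL : ∀ w ∈ L, w ≠ []) :
    (∃ (Γ : Type) (_ : Fintype Γ) (G : RationalGraph A Γ) (I F : Set (List Γ)),
        Regular I ∧ Regular F ∧ G.Lang I F = L) ↔
      (∃ (Λ : Type) (_ : Fintype Λ) (S : TilingSystem A Λ), S.Lang = L) := by
  constructor
  · rintro ⟨Γ, _, G, I, F, hI, hF, rfl⟩
    exact graph_to_tiling G I F hI hF hL
  · rintro ⟨Λ, _, S, rfl⟩
    exact tiling_to_graph S
end
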